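/- arXiv:1006.2416 — 7 statements merged into one kernel-verified Lean document; each statement's English description precedes it below -/
import Mathlib

section
/- Let p, q ≥ 1, let u : Fin p → ℝ and v : Fin q → ℝ have all entries strictly positive with ∑_i u i = ∑_j v j, and assume the classical transportation polytope T(u,v) is generic. Then the number of extreme points of T(u,v) is divisible by gcd(p,q); that is, Nat.gcd p q divides Set.ncard (Set.extremePoints ℝ (T(u,v))). -/
open scoped BigOperators

noncomputable section

/-- The classical `p × q` transportation polytope with marginals `u` and `v`. -/
def transportationPolytope {p q : ℕ} (u : Fin p → ℝ) (v : Fin q → ℝ) :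
    Set (Fin p → Fin q → ℝ) :=
  {x | (∀ i j, 0 ≤ x i j) ∧ (∀ i, ∑ j, x i j = u i) ∧ (∀ j, ∑ i, x i j = v j)}

/-- Genericity of the marginals: no nonempty proper partial sums agree. -/
def IsGeneric {p q : ℕ} (u : Fin p → ℝ) (v : Fin q → ℝ) : Prop :=
  ∀ (Y : Finset (Fin p)) (Z : Finset (Fin q)),
    Y.Nonempty → Y ≠ Finset.univ → Z.Nonempty → Z ≠ Finset.univ →
    ∑ i ∈ Y, u i ≠ ∑ j ∈ Z, v j

namespace FlowPolytope

open Filter Topology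

/-- A potential that is constant along `S` but not constant has a level set that is a union of
components of `S`. -/
lemma exists_closed_of_not_conn {V E : Type*} [Fintype V] {s t : E → V} {S : Finset E}
    {φ : V → ℝ} (hφ : ∀ e ∈ S, φ (s e) = φ (t e)) {a b : V} (hab : φ a ≠ φ b) :
    ∃ X : Finset V, X ≠ ∅ ∧ X ≠ Finset.univ ∧ ∀ e ∈ S, (s e ∈ X ↔ t e ∈ X) := by
  refine ⟨Finset.univ.filter fun k ↦ φ k = φ a, ?_, ?_, ?_⟩
  · exact Finset.Nonempty.ne_empty ⟨a, by simp⟩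
  · intro h
    have hb := Finset.mem_univ b
    rw [← h] at hb
    exact hab (Finset.mem_filter.1 hb).2.symm
  · intro e he
    simp [hφ e he]

variable {V E : Type*} [DecidableEq V] [Fintype E] {s t : E → V}

/-- The net outflow at each vertex of a flow on the digraph with edges `s e ⟶ t e`. -/
def netFlow (s t : E → V) : (E → ℝ) →ₗ[ℝ] (V → ℝ) :=
  ∑ e, (LinearMap.proj e).smulRight (Pi.single (s e) 1 - Pi.single (t e) 1)

/-- The polytope of nonnegative flows with prescribed net outflows. -/
def flowPolytope (s t : E → V) (δ : V → ℝ) : Set (E → ℝ) :=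
  {x | (∀ e, 0 ≤ x e) ∧ netFlow s t x = δ}

/-- An edge set without nontrivial circulations that connects all vertices, i.e. a spanning
tree. -/
structure IsFlowBasis (s t : E → V) (B : Finset E) : Prop where
  indep : ∀ z : E → ℝ, (∀ e ∉ B, z e = 0) → netFlow s t z = 0 → z = 0
  conn : ∀ φ : V → ℝ, (∀ e ∈ B, φ (s e) = φ (t e)) → ∀ a b, φ a = φ b

open Classical in
/-- The flow supported on `B` with net outflow `δ`, if there is one. -/
def basisFlow (s t : E → V) (B : Finset E) (δ : V → ℝ) : E → ℝ :=
  if h : ∃ z : E → ℝ, (∀ e ∉ B, z e = 0) ∧ netFlow s t z = δ then h.choose else 0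

/-- For all small `ε > 0`, the basis flow for `δ + ε • d` is positive on `B`. -/
def IsFeasibleToward (s t : E → V) (δ d : V → ℝ) (B : Finset E) : Prop :=
  ∀ e ∈ B, 0 < basisFlow s t B δ e ∨ (basisFlow s t B δ e = 0 ∧ 0 < basisFlow s t B d e)

lemma netFlow_apply (x : E → ℝ) (k : V) :
    netFlow s t x k = ∑ e, x e * ((if s e = k then 1 else 0) - if t e = k then 1 else 0) := by
  simp [netFlow, LinearMap.sum_apply, Finset.sum_apply, Pi.single_apply, eq_comm]

lemma sum_netFlow (x : E → ℝ) (X : Finset V) :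
    ∑ k ∈ X, netFlow s t x k =
      ∑ e, x e * ((if s e ∈ X then 1 else 0) - if t e ∈ X then 1 else 0) := by
  simp_rw [netFlow_apply]
  rw [Finset.sum_comm]
  simp [← Finset.mul_sum, Finset.sum_sub_distrib]

lemma sum_eq_zero_of_closed {x : E → ℝ} {δ : V → ℝ} (hx : netFlow s t x = δ) {X : Finset V}
    (hX : ∀ e, x e ≠ 0 → (s e ∈ X ↔ t e ∈ X)) : ∑ k ∈ X, δ k = 0 := by
  rw [← hx, sum_netFlow]
  refine Finset.sum_eq_zero fun e _ ↦ ?_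
  by_cases h : x e = 0
  · simp [h]
  · simp [hX e h]

lemma netFlow_single [DecidableEq E] (e : E) :
    netFlow s t (Pi.single e 1) = Pi.single (s e) 1 - Pi.single (t e) 1 := by
  ext k
  simp [netFlow_apply, Pi.single_apply, eq_comm]

lemma basisFlow_apply_of_notMem {B : Finset E} {δ : V → ℝ} {e : E} (he : e ∉ B) :
    basisFlow s t B δ e = 0 := by
  unfold basisFlow
  split_ifs with h
  · exact h.choose_spec.1 e he
  · rfl

lemma IsFlowBasis.eq_of_netFlow_eq {B : Finset E} (hB : IsFlowBasis s t B) {y z : E → ℝ}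
    (hy : ∀ e ∉ B, y e = 0) (hz : ∀ e ∉ B, z e = 0) (h : netFlow s t y = netFlow s t z) : y = z :=
  sub_eq_zero.1 <| hB.indep _ (fun e he ↦ by simp [hy e he, hz e he]) (by simp [h])

/-- A single edge across a cut carries the whole net outflow of the cut. -/
lemma sum_eq_of_unique_crossing [DecidableEq E] {S : Finset E} {X : Finset V} {e : E} {z : E → ℝ}
    (hz : ∀ f ∉ insert e S, z f = 0) (hX : ∀ f ∈ S, (s f ∈ X ↔ t f ∈ X)) :
    ∑ k ∈ X, netFlow s t z k = z e * ((if s e ∈ X then 1 else 0) - if t e ∈ X then 1 else 0) := by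
  rw [sum_netFlow]
  refine Finset.sum_eq_single e (fun f _ hf ↦ ?_) (by simp)
  by_cases h : f ∈ S
  · simp [hX f h]
  · simp [hz f (by simp [h, hf])]

/-- The edges on which the basis flow is positive. -/
def posSupport (s t : E → V) (δ : V → ℝ) (B : Finset E) : Finset E := by
  classical exact {e ∈ B | 0 < basisFlow s t B δ e}

lemma posSupport_subset (δ : V → ℝ) (B : Finset E) : posSupport s t δ B ⊆ B := by
  classical exact Finset.filter_subset _ _

lemma basisFlow_pos_of_mem {δ : V → ℝ} {B : Finset E} {e : E} (he : e ∈ posSupport s t δ B) :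
    0 < basisFlow s t B δ e := by
  simp only [posSupport, Finset.mem_filter] at he
  exact he.2

lemma IsFeasibleToward.apply_eq_zero {δ d : V → ℝ} {B : Finset E}
    (h : IsFeasibleToward s t δ d B) {e : E} (he : e ∉ posSupport s t δ B) :
    basisFlow s t B δ e = 0 := by
  by_cases heB : e ∈ B
  · rcases h e heB with h | h
    · exact absurd (by simp [posSupport, heB, h]) he
    · exact h.1
  · exact basisFlow_apply_of_notMem heB

lemma IsFeasibleToward.nonneg {δ d : V → ℝ} {B : Finset E}
    (h : IsFeasibleToward s t δ d B) (e : E) : 0 ≤ basisFlow s t B δ e := by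
  by_cases he : e ∈ posSupport s t δ B
  · exact (basisFlow_pos_of_mem he).le
  · exact (h.apply_eq_zero he).ge

variable [Fintype V]

namespace IsFlowBasis

variable {B : Finset E}

lemma exists_flow (hB : IsFlowBasis s t B) {d : V → ℝ} (hd : ∑ k, d k = 0) :
    ∃ z : E → ℝ, (∀ e ∉ B, z e = 0) ∧ netFlow s t z = d := by
  classical
  let p : Submodule ℝ (E → ℝ) :=
    { carrier := {z | ∀ e ∉ B, z e = 0}
      add_mem' := fun ha hb e he ↦ by simp [ha e he, hb e he]
      zero_mem' := fun e _ ↦ rfl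
      smul_mem' := fun c z hz e he ↦ by simp [hz e he] }
  suffices d ∈ p.map (netFlow s t) by
    obtain ⟨z, hz, hzd⟩ := this
    exact ⟨z, hz, hzd⟩
  by_contra hd'
  obtain ⟨f, hf, hle⟩ := Submodule.exists_le_ker_of_notMem hd'
  have hconst := hB.conn (fun k ↦ f (Pi.single k 1)) fun e he ↦ by
    have : f (netFlow s t (Pi.single e 1)) = 0 :=
      hle (Submodule.mem_map_of_mem fun e' he' ↦
        Pi.single_eq_of_ne (by rintro rfl; exact he' he) _)
    rwa [netFlow_single, map_sub, sub_eq_zero] at this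
  apply hf
  rw [LinearMap.pi_apply_eq_sum_univ f d]
  rcases isEmpty_or_nonempty V with hV | ⟨⟨a⟩⟩
  · simp
  · have h (k : V) : f (fun j ↦ if k = j then 1 else 0) = f (Pi.single a 1) := by
      rw [← hconst k a]
      congr 1
      ext j
      simp [Pi.single_apply, eq_comm]
    simp_rw [h, smul_eq_mul, ← Finset.sum_mul, hd, zero_mul]

lemma netFlow_basisFlow (hB : IsFlowBasis s t B) {d : V → ℝ} (hd : ∑ k, d k = 0) :
    netFlow s t (basisFlow s t B d) = d := by
  have h := hB.exists_flow hd
  rw [basisFlow, dif_pos h]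
  exact h.choose_spec.2

lemma basisFlow_eq (hB : IsFlowBasis s t B) {d : V → ℝ} (hd : ∑ k, d k = 0) {z : E → ℝ}
    (hz : ∀ e ∉ B, z e = 0) (h : netFlow s t z = d) : basisFlow s t B d = z :=
  hB.eq_of_netFlow_eq (fun _ ↦ basisFlow_apply_of_notMem) hz (by rw [hB.netFlow_basisFlow hd, h])

lemma basisFlow_add_smul (hB : IsFlowBasis s t B) {δ d : V → ℝ} (hδ : ∑ k, δ k = 0)
    (hd : ∑ k, d k = 0) (c : ℝ) :
    basisFlow s t B (δ + c • d) = basisFlow s t B δ + c • basisFlow s t B d := by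
  apply hB.basisFlow_eq
  · simp [Finset.sum_add_distrib, ← Finset.mul_sum, hδ, hd]
  · intro e he
    simp [basisFlow_apply_of_notMem he]
  · simp [hB.netFlow_basisFlow, hδ, hd]

lemma basisFlow_neg (hB : IsFlowBasis s t B) {d : V → ℝ} (hd : ∑ k, d k = 0) :
    basisFlow s t B (-d) = -basisFlow s t B d := by
  apply hB.basisFlow_eq
  · simp [hd]
  · intro e he
    simp [basisFlow_apply_of_notMem he]
  · simp [hB.netFlow_basisFlow, hd]

lemma eq_of_subset {B' : Finset E} (hB : IsFlowBasis s t B) (hB' : IsFlowBasis s t B')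
    (h : B ⊆ B') : B = B' := by
  classical
  refine h.antisymm fun e he ↦ ?_
  by_contra heB
  obtain ⟨z, hz, hze⟩ := hB.exists_flow (d := netFlow s t (Pi.single e 1)) (by
    simp [netFlow_single, Finset.sum_sub_distrib])
  have := hB'.eq_of_netFlow_eq (fun e' he' ↦ hz e' fun h' ↦ he' (h h'))
    (fun e' he' ↦ Pi.single_eq_of_ne (by rintro rfl; exact he' he) _) hze
  simpa [hz e heB] using congrFun this e

lemma eq_of_conn {S : Finset E} (hB : IsFlowBasis s t B) (h : S ⊆ B)
    (hS : ∀ φ : V → ℝ, (∀ e ∈ S, φ (s e) = φ (t e)) → ∀ a b, φ a = φ b) : S = B :=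
  eq_of_subset ⟨fun z hz ↦ hB.indep z fun e he ↦ hz e fun h' ↦ he (h h'), hS⟩ hB h

/-- Joining the two components of a spanning forest by an edge gives a spanning tree. -/
lemma insert_of_crossing [DecidableEq E] {S : Finset E} {X : Finset V} {e : E}
    (hS : ∀ z : E → ℝ, (∀ e ∉ S, z e = 0) → netFlow s t z = 0 → z = 0)
    (hX : ∀ f ∈ S, (s f ∈ X ↔ t f ∈ X))
    (huniq : ∀ X' : Finset V, X' ≠ ∅ → X' ≠ Finset.univ → (∀ f ∈ S, (s f ∈ X' ↔ t f ∈ X')) →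
      X' = X ∨ X' = Xᶜ)
    (he : ¬(s e ∈ X ↔ t e ∈ X)) : IsFlowBasis s t (insert e S) := by
  refine ⟨fun z hz hz0 ↦ hS z (fun f hf ↦ ?_) hz0, fun φ hφ a b ↦ ?_⟩
  · have h := sum_eq_of_unique_crossing hz hX
    rw [hz0] at h
    by_cases hfe : f = e
    · subst hfe
      by_cases h1 : s f ∈ X <;> by_cases h2 : t f ∈ X <;> simp_all
    · exact hz f (by simp [hf, hfe])
  · by_contra hab
    obtain ⟨X', h1, h2, h3⟩ := exists_closed_of_not_conn hφ hab
    have h4 := h3 e (Finset.mem_insert_self _ _)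
    rcases huniq X' h1 h2 fun f hf ↦ h3 f (Finset.mem_insert_of_mem hf) with rfl | rfl
    · exact he h4
    · simp only [Finset.mem_compl] at h4
      exact he (not_iff_not.1 h4)

end IsFlowBasis

open IsFlowBasis

/-- If every vertex has the same in- and outdegree modulo `g`, so does every cut. -/
lemma card_crossing_eq {g : ℕ}
    (hg : ∀ k, ((({e | s e = k} : Finset E).card : ℕ) : ZMod g) = ({e | t e = k} : Finset E).card)
    (X : Finset V) :
    ((({e | s e ∈ X ∧ t e ∉ X} : Finset E).card : ℕ) : ZMod g) =
      ({e | s e ∈ Xᶜ ∧ t e ∉ Xᶜ} : Finset E).card := by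
  have key (r : E → V) : ({e | r e ∈ X} : Finset E).card =
      ∑ k ∈ X, ({e | r e = k} : Finset E).card := by
    rw [Finset.card_eq_sum_card_fiberwise (f := r) (t := X) (fun e he ↦ by simpa using he)]
    refine Finset.sum_congr rfl fun k hk ↦ ?_
    congr 1
    ext e
    simp only [Finset.mem_filter, Finset.mem_univ, true_and]
    exact ⟨fun h ↦ h.2, fun h ↦ ⟨h ▸ hk, h⟩⟩
  have h1 : ((({e | s e ∈ X} : Finset E).card : ℕ) : ZMod g) =
      ({e | t e ∈ X} : Finset E).card := by
    rw [key, key]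
    push_cast
    exact Finset.sum_congr rfl fun k _ ↦ hg k
  have h2 := Finset.card_filter_add_card_filter_not (s := ({e | s e ∈ X} : Finset E))
    (fun e ↦ t e ∈ X)
  have h3 := Finset.card_filter_add_card_filter_not (s := ({e | t e ∈ X} : Finset E))
    (fun e ↦ s e ∈ X)
  simp only [Finset.filter_filter] at h2 h3
  rw [← h2, ← h3] at h1
  push_cast at h1
  simp only [Finset.mem_compl, not_not]
  simp_rw [and_comm (a := t _ ∈ X)] at h1
  exact add_left_cancel h1

lemma eventually_affine_sign_iff {a b c : ℝ} (h : b = 0 → c = 0) :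
    ∀ᶠ ε in 𝓝[>] (0 : ℝ), (0 < a + ε * b ∨ (a + ε * b = 0 ∧ 0 < c)) ↔
      (0 < a ∨ (a = 0 ∧ 0 < b)) := by
  have hlim : Tendsto (fun ε : ℝ ↦ a + ε * b) (𝓝[>] 0) (𝓝 a) := by
    have : Tendsto (fun ε : ℝ ↦ a + ε * b) (𝓝 0) (𝓝 (a + 0 * b)) :=
      Continuous.tendsto (by fun_prop) 0
    simpa using this.mono_left nhdsWithin_le_nhds
  rcases lt_trichotomy a 0 with ha | rfl | ha
  · filter_upwards [hlim.eventually_lt_const ha] with ε hε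
    simp [hε.not_gt, hε.ne, ha.not_gt, ha.ne]
  · filter_upwards [self_mem_nhdsWithin] with ε (hε : 0 < ε)
    simp only [zero_add, mul_pos_iff_of_pos_left hε, mul_eq_zero, hε.ne', false_or, lt_irrefl,
      true_and, or_iff_left_iff_imp, and_imp]
    intro hb hc
    simp [h hb] at hc
  · filter_upwards [hlim.eventually_const_lt ha] with ε hε
    simp [hε, ha]

lemma IsFlowBasis.eventually_isFeasibleToward_iff {B : Finset E} (hB : IsFlowBasis s t B)
    {δ d d' : V → ℝ} (hδ : ∑ k, δ k = 0) (hd' : ∑ k, d' k = 0) (h : d = d' ∨ d = -d') :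
    ∀ᶠ ε in 𝓝[>] (0 : ℝ),
      IsFeasibleToward s t (δ + ε • d') d B ↔ IsFeasibleToward s t δ d' B := by
  have key : ∀ᶠ ε in 𝓝[>] (0 : ℝ), ∀ e,
      (0 < basisFlow s t B δ e + ε * basisFlow s t B d' e ∨
        (basisFlow s t B δ e + ε * basisFlow s t B d' e = 0 ∧ 0 < basisFlow s t B d e)) ↔
      (0 < basisFlow s t B δ e ∨ (basisFlow s t B δ e = 0 ∧ 0 < basisFlow s t B d' e)) := by
    refine eventually_all.2 fun e ↦ eventually_affine_sign_iff fun h0 ↦ ?_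
    rcases h with rfl | rfl
    · exact h0
    · simp [hB.basisFlow_neg hd', h0]
  filter_upwards [key] with ε hε
  simp only [IsFeasibleToward, hB.basisFlow_add_smul hδ hd', Pi.add_apply, Pi.smul_apply,
    smul_eq_mul, hε]

lemma conn_of_generic {δ : V → ℝ}
    (hgen : ∀ X : Finset V, X ≠ ∅ → X ≠ Finset.univ → ∑ k ∈ X, δ k ≠ 0) {x : E → ℝ}
    (hx : netFlow s t x = δ) {S : Finset E} (hxS : ∀ e ∉ S, x e = 0) (φ : V → ℝ)
    (hφ : ∀ e ∈ S, φ (s e) = φ (t e)) (a b : V) : φ a = φ b := by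
  by_contra hab
  obtain ⟨X, hX0, hX1, hX⟩ := exists_closed_of_not_conn hφ hab
  exact hgen X hX0 hX1 (sum_eq_zero_of_closed hx fun e he ↦ hX e (by_contra fun h ↦ he (hxS e h)))

/-- The vertices of a generic flow polytope are its positive basis flows. -/
lemma extremePoints_flowPolytope {δ : V → ℝ} (hδ : ∑ k, δ k = 0)
    (hgen : ∀ X : Finset V, X ≠ ∅ → X ≠ Finset.univ → ∑ k ∈ X, δ k ≠ 0) :
    Set.extremePoints ℝ (flowPolytope s t δ) = (fun B ↦ basisFlow s t B δ) ''
      {B | IsFlowBasis s t B ∧ ∀ e ∈ B, 0 < basisFlow s t B δ e} := by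
  classical
  ext x
  constructor
  · rintro ⟨⟨hx0, hx⟩, hext⟩
    let S : Finset E := {e | 0 < x e}
    have hxS : ∀ e ∉ S, x e = 0 := fun e he ↦
      le_antisymm (by simpa [S] using he) (hx0 e)
    have hB : IsFlowBasis s t S := by
      refine ⟨fun z hz hz0 ↦ ?_, conn_of_generic hgen hx hxS⟩
      have hev : ∀ᶠ ε in 𝓝[>] (0 : ℝ), ∀ e, 0 ≤ x e + ε * z e ∧ 0 ≤ x e - ε * z e := by
        refine eventually_all.2 fun e ↦ ?_
        by_cases he : e ∈ S
        · have hpos : 0 < x e := by simpa [S] using he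
          have h1 : Tendsto (fun ε : ℝ ↦ x e + ε * z e) (𝓝 0) (𝓝 (x e + 0 * z e)) :=
            Continuous.tendsto (by fun_prop) 0
          have h2 : Tendsto (fun ε : ℝ ↦ x e - ε * z e) (𝓝 0) (𝓝 (x e - 0 * z e)) :=
            Continuous.tendsto (by fun_prop) 0
          filter_upwards [nhdsWithin_le_nhds (h1.eventually_const_lt (by simpa using hpos)),
            nhdsWithin_le_nhds (h2.eventually_const_lt (by simpa using hpos))] with ε h h'
          exact ⟨h.le, h'.le⟩
        · simp [hz e he, hx0 e]
      obtain ⟨ε, hε, hεpos⟩ := (hev.and self_mem_nhdsWithin).exists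
      have hεpos : 0 < ε := hεpos
      have := hext (x₁ := x + ε • z) ⟨fun e ↦ (hε e).1, by simp [hx, hz0]⟩
        (x₂ := x - ε • z) ⟨fun e ↦ (hε e).2, by simp [hx, hz0]⟩
        ⟨1 / 2, 1 / 2, by norm_num, by norm_num, by norm_num, by module⟩
      simpa [hεpos.ne'] using this
    have hBx := hB.basisFlow_eq hδ hxS hx
    exact ⟨S, ⟨hB, fun e he ↦ by rw [hBx]; simpa [S] using he⟩, hBx⟩
  · rintro ⟨B, ⟨hB, hpos⟩, rfl⟩
    refine ⟨⟨fun e ↦ ?_, hB.netFlow_basisFlow hδ⟩, ?_⟩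
    · by_cases he : e ∈ B
      · exact (hpos e he).le
      · exact (basisFlow_apply_of_notMem he).ge
    · rintro y ⟨hy0, hy⟩ z ⟨hz0, hz⟩ ⟨a, b, ha, hb, hab, hyz⟩
      refine (hB.basisFlow_eq hδ (fun e he ↦ ?_) hy).symm
      have h := congrFun hyz e
      simp only [Pi.add_apply, Pi.smul_apply, smul_eq_mul, basisFlow_apply_of_notMem he] at h
      have h1 := mul_nonneg ha.le (hy0 e)
      have h2 := mul_nonneg hb.le (hz0 e)
      have h3 : a * y e = 0 := by linarith
      exact (mul_eq_zero.1 h3).resolve_left ha.ne'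

variable [DecidableEq E]

/-- The spanning trees extending a forest `S` with components `X` and `Xᶜ` that become feasible in
a direction moving supply into `X` are given by the edges from `X` to `Xᶜ`. -/
lemma card_fiber_eq_card_crossing [DecidablePred (IsFlowBasis s t)] {δ d : V → ℝ}
    [DecidablePred (IsFeasibleToward s t δ d)]
    (hδ : ∑ k, δ k = 0) (hd : ∑ k, d k = 0) {S : Finset E} {X : Finset V} {x : E → ℝ}
    (hS : ∀ z : E → ℝ, (∀ e ∉ S, z e = 0) → netFlow s t z = 0 → z = 0)
    (hxS : ∀ e ∉ S, x e = 0) (hxpos : ∀ e ∈ S, 0 < x e) (hx : netFlow s t x = δ)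
    (hX0 : X ≠ ∅) (hX1 : X ≠ Finset.univ) (hX : ∀ f ∈ S, (s f ∈ X ↔ t f ∈ X))
    (huniq : ∀ X' : Finset V, X' ≠ ∅ → X' ≠ Finset.univ → (∀ f ∈ S, (s f ∈ X' ↔ t f ∈ X')) →
      X' = X ∨ X' = Xᶜ)
    (hdX : 0 < ∑ k ∈ X, d k) :
    ({B : Finset E | (IsFlowBasis s t B ∧ IsFeasibleToward s t δ d B) ∧
      posSupport s t δ B = S} : Finset (Finset E)).card =
    ({e | s e ∈ X ∧ t e ∉ X} : Finset E).card := by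
  symm
  have hflow {e : E} (hB : IsFlowBasis s t (insert e S)) : basisFlow s t (insert e S) δ = x :=
    hB.basisFlow_eq hδ (fun f hf ↦ hxS f fun h ↦ hf (Finset.mem_insert_of_mem h)) hx
  have hdir {e : E} (hB : IsFlowBasis s t (insert e S)) :
      ∑ k ∈ X, d k = basisFlow s t (insert e S) d e *
        ((if s e ∈ X then 1 else 0) - if t e ∈ X then 1 else 0) := by
    rw [← sum_eq_of_unique_crossing (fun f ↦ basisFlow_apply_of_notMem) hX,
      hB.netFlow_basisFlow hd]
  have hnot {e : E} (he : ¬(s e ∈ X ↔ t e ∈ X)) : e ∉ S := fun h ↦ he (hX e h)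
  refine Finset.card_bij (fun e _ ↦ insert e S) ?_ ?_ ?_
  · intro e he
    simp only [Finset.mem_filter, Finset.mem_univ, true_and] at he
    have hcross : ¬(s e ∈ X ↔ t e ∈ X) := by tauto
    have hB := insert_of_crossing hS hX huniq hcross
    simp only [Finset.mem_filter, Finset.mem_univ, true_and]
    refine ⟨⟨hB, fun f hf ↦ ?_⟩, ?_⟩
    · rw [hflow hB]
      rcases Finset.mem_insert.1 hf with rfl | hf
      · refine Or.inr ⟨hxS _ (hnot hcross), ?_⟩
        have := hdir hB
        simp only [he.1, he.2, if_true, if_false, sub_zero, mul_one] at this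
        exact this ▸ hdX
      · exact Or.inl (hxpos f hf)
    · ext f
      simp only [posSupport, hflow hB, Finset.mem_filter, Finset.mem_insert]
      constructor
      · rintro ⟨-, h⟩
        by_contra hf
        exact h.ne' (hxS f hf)
      · exact fun h ↦ ⟨Or.inr h, hxpos f h⟩
  · intro e he f hf hef
    simp only [Finset.mem_filter, Finset.mem_univ, true_and] at he hf
    have : e ∈ insert f S := hef ▸ Finset.mem_insert_self e S
    exact (Finset.mem_insert.1 this).resolve_right (hnot (by tauto))
  · intro B hB
    simp only [Finset.mem_filter, Finset.mem_univ, true_and] at hB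
    obtain ⟨⟨hB, hfeas⟩, hsupp⟩ := hB
    have hSB : S ⊆ B := hsupp ▸ posSupport_subset δ B
    obtain ⟨e, heB, he⟩ : ∃ e ∈ B, ¬(s e ∈ X ↔ t e ∈ X) := by
      by_contra! h
      obtain ⟨a, ha⟩ := Finset.nonempty_iff_ne_empty.2 hX0
      obtain ⟨b, hb⟩ : ∃ b, b ∉ X := by
        by_contra! hall
        exact hX1 (Finset.eq_univ_iff_forall.2 hall)
      have := hB.conn (fun k ↦ if k ∈ X then 1 else 0) (fun e he ↦ by simp [h e he]) a b
      simp [ha, hb] at this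
    have hB' := insert_of_crossing hS hX huniq he
    have hBe : insert e S = B := hB'.eq_of_subset hB (Finset.insert_subset heB hSB)
    subst hBe
    have hpos : 0 < basisFlow s t (insert e S) d e := by
      have h := hfeas e heB
      rw [hflow hB, hxS e (hnot he)] at h
      simpa using h
    refine ⟨e, ?_, rfl⟩
    have := hdir hB
    simp only [Finset.mem_filter, Finset.mem_univ, true_and]
    by_cases h1 : s e ∈ X <;> by_cases h2 : t e ∈ X <;> simp [h1, h2] at this he ⊢
    linarith

/-- The number of feasible spanning trees modulo `g` is the same on both sides of `δ`. -/
lemma card_feasible_neg_eq [DecidablePred (IsFlowBasis s t)] {g : ℕ} {δ d : V → ℝ}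
    [DecidablePred (IsFeasibleToward s t δ d)] [DecidablePred (IsFeasibleToward s t δ (-d))]
    (hg : ∀ k, ((({e | s e = k} : Finset E).card : ℕ) : ZMod g) = ({e | t e = k} : Finset E).card)
    (hδ : ∑ k, δ k = 0) (hd : ∑ k, d k = 0)
    (hwall : ∀ X : Finset V, X ≠ ∅ → X ≠ Finset.univ → ∑ k ∈ X, δ k = 0 → ∑ k ∈ X, d k ≠ 0)
    (huniq : ∀ X X' : Finset V, X ≠ ∅ → X ≠ Finset.univ → ∑ k ∈ X, δ k = 0 →
      X' ≠ ∅ → X' ≠ Finset.univ → ∑ k ∈ X', δ k = 0 → X' = X ∨ X' = Xᶜ) :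
    ((({B | IsFlowBasis s t B ∧ IsFeasibleToward s t δ d B} : Finset (Finset E)).card : ℕ) :
      ZMod g) =
    ({B | IsFlowBasis s t B ∧ IsFeasibleToward s t δ (-d) B} : Finset (Finset E)).card := by
  have hd' : ∑ k, (-d) k = 0 := by simp [hd]
  rw [Finset.card_eq_sum_card_fiberwise (f := posSupport s t δ) (t := Finset.univ) (by simp),
    Finset.card_eq_sum_card_fiberwise (f := posSupport s t δ) (t := Finset.univ) (by simp)]
  push_cast
  refine Finset.sum_congr rfl fun S _ ↦ ?_
  simp only [Finset.filter_filter]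
  by_cases hex : ∃ B d', IsFlowBasis s t B ∧ IsFeasibleToward s t δ d' B ∧ posSupport s t δ B = S
  swap
  · push Not at hex
    rw [Finset.card_eq_zero.2, Finset.card_eq_zero.2]
    · simp only [Finset.filter_eq_empty_iff, Finset.mem_univ, true_imp_iff]
      exact fun B h ↦ hex B _ h.1.1 h.1.2 h.2
    · simp only [Finset.filter_eq_empty_iff, Finset.mem_univ, true_imp_iff]
      exact fun B h ↦ hex B _ h.1.1 h.1.2 h.2
  obtain ⟨B, d', hB, hfeas, rfl⟩ := hex
  set S := posSupport s t δ B with hSdef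
  by_cases hconn : ∀ φ : V → ℝ, (∀ e ∈ S, φ (s e) = φ (t e)) → ∀ a b, φ a = φ b
  · have hall {B' : Finset E} (d₁ : V → ℝ) (hB' : IsFlowBasis s t B')
        (h : posSupport s t δ B' = S) : IsFeasibleToward s t δ d₁ B' := fun e he ↦ by
      have hS : S = B' := hB'.eq_of_conn (h ▸ posSupport_subset δ B') hconn
      exact Or.inl (basisFlow_pos_of_mem (by rwa [h, hS]))
    congr 2
    ext B'
    simp only [Finset.mem_filter, Finset.mem_univ, true_and]
    exact ⟨fun h ↦ ⟨⟨h.1.1, hall _ h.1.1 h.2⟩, h.2⟩, fun h ↦ ⟨⟨h.1.1, hall _ h.1.1 h.2⟩, h.2⟩⟩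
  push Not at hconn
  obtain ⟨φ, hφ, a, b, hab⟩ := hconn
  have hx : netFlow s t (basisFlow s t B δ) = δ := hB.netFlow_basisFlow hδ
  have hxS : ∀ e ∉ S, basisFlow s t B δ e = 0 := fun e ↦ hfeas.apply_eq_zero
  have hxpos : ∀ e ∈ S, 0 < basisFlow s t B δ e := fun e ↦ basisFlow_pos_of_mem
  have hS : ∀ z : E → ℝ, (∀ e ∉ S, z e = 0) → netFlow s t z = 0 → z = 0 := fun z hz ↦
    hB.indep z fun e he ↦ hz e fun h ↦ he (posSupport_subset δ B h)
  have hbal (X : Finset V) (hX : ∀ f ∈ S, (s f ∈ X ↔ t f ∈ X)) : ∑ k ∈ X, δ k = 0 :=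
    sum_eq_zero_of_closed hx fun e he ↦ hX e (by_contra fun h ↦ he (hxS e h))
  have hcompl (f : V → ℝ) (hf : ∑ k, f k = 0) (X : Finset V) :
      ∑ k ∈ Xᶜ, f k = -∑ k ∈ X, f k := by
    rw [← Finset.sum_add_sum_compl X] at hf
    linarith
  obtain ⟨X, hX0, hX1, hX, hdX⟩ : ∃ X : Finset V, X ≠ ∅ ∧ X ≠ Finset.univ ∧
      (∀ e ∈ S, (s e ∈ X ↔ t e ∈ X)) ∧ 0 < ∑ k ∈ X, d k := by
    obtain ⟨X, hX0, hX1, hX⟩ := exists_closed_of_not_conn hφ hab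
    rcases (hwall X hX0 hX1 (hbal X hX)).lt_or_gt with h | h
    · refine ⟨Xᶜ, by simpa using hX1, by simpa using hX0, by simpa [not_iff_not] using hX, ?_⟩
      rw [hcompl d hd]
      linarith
    · exact ⟨X, hX0, hX1, hX, h⟩
  have hX' : ∀ e ∈ S, (s e ∈ Xᶜ ↔ t e ∈ Xᶜ) := by simpa [not_iff_not] using hX
  have hu : ∀ X' : Finset V, X' ≠ ∅ → X' ≠ Finset.univ → (∀ f ∈ S, (s f ∈ X' ↔ t f ∈ X')) →
      X' = X ∨ X' = Xᶜ := fun X' h0 h1 h ↦ huniq X X' hX0 hX1 (hbal X hX) h0 h1 (hbal X' h)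
  rw [card_fiber_eq_card_crossing hδ hd hS hxS hxpos hx hX0 hX1 hX hu hdX,
    card_fiber_eq_card_crossing hδ hd' hS hxS hxpos hx (X := Xᶜ) (by simpa using hX1)
      (by simpa using hX0) hX' (fun X' h0 h1 h ↦ by simpa [or_comm] using hu X' h0 h1 h)
      (by rw [hcompl _ hd']; simpa using hdX)]
  exact card_crossing_eq hg X

/-- A direction along which `δ` becomes balanced on only one cut at a time. -/
lemma exists_simple_direction {δ : V → ℝ}
    (hgen : ∀ X : Finset V, X ≠ ∅ → X ≠ Finset.univ → ∑ k ∈ X, δ k ≠ 0) {a b : V} (hab : a ≠ b) :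
    ∃ d : V → ℝ, ∑ k, d k = 0 ∧ d a ≠ 0 ∧
      ∀ X X' : Finset V, X ≠ ∅ → X ≠ Finset.univ → X' ≠ ∅ → X' ≠ Finset.univ → X' ≠ X →
        X' ≠ Xᶜ →
        (∑ k ∈ X, δ k) * ∑ k ∈ X', d k ≠ (∑ k ∈ X', δ k) * ∑ k ∈ X, d k := by
  let I := {P : Finset V × Finset V // P.1 ≠ ∅ ∧ P.1 ≠ Finset.univ ∧ P.2 ≠ ∅ ∧
    P.2 ≠ Finset.univ ∧ P.2 ≠ P.1 ∧ P.2 ≠ P.1ᶜ}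
  let σ (X : Finset V) : Module.Dual ℝ (V → ℝ) := ∑ k ∈ X, LinearMap.proj k
  have hσ (X : Finset V) (d : V → ℝ) : σ X d = ∑ k ∈ X, d k := by
    simp [σ, LinearMap.sum_apply]
  let F : Option I → Module.Dual ℝ (V → ℝ) := fun o ↦
    o.elim (LinearMap.proj a) fun P ↦
      (∑ k ∈ P.1.1, δ k) • σ P.1.2 - (∑ k ∈ P.1.2, δ k) • σ P.1.1
  have hmem (x y : V) :
      (Pi.single x 1 - Pi.single y 1 : V → ℝ) ∈ LinearMap.ker (σ Finset.univ) := by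
    simp [hσ, Finset.sum_sub_distrib]
  obtain ⟨d, hd0, hd⟩ := Module.Dual.exists_forall_mem_ne_zero_of_forall_exists
    (LinearMap.ker (σ Finset.univ)) F (by
    rintro (_ | ⟨⟨X, X'⟩, h1, h2, h3, h4, h5, h6⟩)
    · exact ⟨_, hmem a b, by simp [F, hab]⟩
    · by_contra! hcon
      have hα := hgen X h1 h2
      have hβ := hgen X' h3 h4
      simp only at h1 h2 h3 h4 h5 h6
      set α := ∑ k ∈ X, δ k
      set β := ∑ k ∈ X', δ k
      have hxy (x y : V) : α * (if x ∈ X' then 1 else 0) - β * (if x ∈ X then 1 else 0) =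
          α * (if y ∈ X' then 1 else 0) - β * (if y ∈ X then 1 else 0) := by
        have := hcon _ (hmem x y)
        simp only [F, Option.elim, LinearMap.sub_apply, LinearMap.smul_apply, hσ, Pi.sub_apply,
          Finset.sum_sub_distrib, Pi.single_apply, Finset.sum_ite_eq', smul_eq_mul] at this
        linarith
      obtain ⟨x, hx⟩ : ∃ x, x ∈ X ∧ x ∈ X' ∨ x ∉ X ∧ x ∉ X' := by
        by_contra! h
        apply h6
        ext k
        have := h k
        rw [Finset.mem_compl]
        tauto
      obtain ⟨y, hy⟩ : ∃ y, ¬(y ∈ X' ↔ y ∈ X) := by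
        by_contra! h
        exact h5 (Finset.ext h)
      have := hxy x y
      by_cases hy1 : y ∈ X <;> by_cases hy2 : y ∈ X' <;> rcases hx with hx | hx <;>
        simp [hx, hy1, hy2] at this hy <;> first | exact hα (by linarith) | exact hβ (by linarith))
  refine ⟨d, by simpa [hσ] using hd0, hd none, fun X X' h1 h2 h3 h4 h5 h6 heq ↦ ?_⟩
  apply hd (some ⟨(X, X'), h1, h2, h3, h4, h5, h6⟩)
  simp [F, hσ, heq]

/-- If every vertex has the same in- and outdegree modulo `g` and some vertex is a sink, then the
number of vertices of a generic flow polytope is divisible by `g`. -/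
theorem dvd_ncard_extremePoints_flowPolytope {g : ℕ} {δ : V → ℝ}
    (hg : ∀ k, ((({e | s e = k} : Finset E).card : ℕ) : ZMod g) = ({e | t e = k} : Finset E).card)
    (hδ : ∑ k, δ k = 0)
    (hgen : ∀ X : Finset V, X ≠ ∅ → X ≠ Finset.univ → ∑ k ∈ X, δ k ≠ 0)
    {a b : V} (hab : a ≠ b) (ha : ∀ e, s e ≠ a) :
    g ∣ (Set.extremePoints ℝ (flowPolytope s t δ)).ncard := by
  classical
  obtain ⟨d, hd, hda, hdgen⟩ := exists_simple_direction hgen hab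
  have hsum (τ : ℝ) : ∑ k, (δ + τ • d) k = 0 := by
    simp [Finset.sum_add_distrib, ← Finset.mul_sum, hδ, hd]
  have hX (τ : ℝ) (X : Finset V) : ∑ k ∈ X, (δ + τ • d) k = ∑ k ∈ X, δ k + τ * ∑ k ∈ X, d k := by
    simp [Finset.sum_add_distrib, ← Finset.mul_sum]
  let N (δ d : V → ℝ) : ZMod g :=
    (({B | IsFlowBasis s t B ∧ IsFeasibleToward s t δ d B} : Finset (Finset E)).card : ℕ)
  have hcross (τ : ℝ) : N (δ + τ • d) d = N (δ + τ • d) (-d) := by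
    refine card_feasible_neg_eq hg (hsum τ) hd (fun X h0 h1 h h' ↦ ?_)
      fun X X' h1 h2 h h3 h4 h' ↦ ?_
    · rw [hX, h', mul_zero, add_zero] at h
      exact hgen X h0 h1 h
    · by_contra! hne
      refine hdgen X X' h1 h2 h3 h4 hne.1 hne.2 ?_
      rw [hX] at h h'
      linear_combination (∑ k ∈ X', d k) * h - (∑ k ∈ X, d k) * h'
  have hmove (δ d d' : V → ℝ) (hδ : ∑ k, δ k = 0) (hd' : ∑ k, d' k = 0) (h : d = d' ∨ d = -d') :
      ∀ᶠ ε in 𝓝[>] (0 : ℝ), N (δ + ε • d') d = N δ d' := by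
    have : ∀ᶠ ε in 𝓝[>] (0 : ℝ), ∀ B, IsFlowBasis s t B →
        (IsFeasibleToward s t (δ + ε • d') d B ↔ IsFeasibleToward s t δ d' B) :=
      eventually_all.2 fun B ↦ by
        by_cases hB : IsFlowBasis s t B
        · simpa [hB] using hB.eventually_isFeasibleToward_iff hδ hd' h
        · simp [hB]
    filter_upwards [this] with ε hε
    simp only [N]
    congr 2
    ext B
    simp only [Finset.mem_filter, Finset.mem_univ, true_and]
    exact and_congr_right (hε B)
  have hconst : IsLocallyConstant fun τ : ℝ ↦ N (δ + τ • d) d := by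
    rw [IsLocallyConstant.iff_eventually_eq]
    intro τ
    have h1 := hmove (δ + τ • d) d d (hsum τ) hd (Or.inl rfl)
    have h2 := hmove (δ + τ • d) d (-d) (hsum τ) (by simp [hd]) (Or.inr (by simp))
    obtain ⟨r, hr, hsub⟩ := mem_nhdsGT_iff_exists_Ioo_subset.1 (h1.and h2)
    filter_upwards [Metric.ball_mem_nhds τ hr] with y hy
    rw [Metric.mem_ball, Real.dist_eq, abs_lt] at hy
    rcases lt_trichotomy y τ with h | rfl | h
    · have := (hsub (show τ - y ∈ Set.Ioo 0 r from ⟨by linarith, by linarith⟩)).2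
      rw [hcross τ, ← this]
      congr 1
      module
    · rfl
    · have := (hsub (show y - τ ∈ Set.Ioo 0 r from ⟨by linarith, by linarith⟩)).1
      rw [← this]
      congr 1
      module
  have hzero : N (δ + ((1 - δ a) / d a) • d) d = 0 := by
    simp only [N]
    rw [Finset.card_eq_zero.2, Nat.cast_zero]
    simp only [Finset.filter_eq_empty_iff, Finset.mem_univ, true_imp_iff]
    rintro B ⟨hB, hfeas⟩
    have h := congrFun (hB.netFlow_basisFlow (hsum ((1 - δ a) / d a))) a
    have h1 : (δ + ((1 - δ a) / d a) • d) a = 1 := by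
      simp [hda]
    rw [h1, netFlow_apply] at h
    have : ∑ e, basisFlow s t B (δ + ((1 - δ a) / d a) • d) e *
        ((if s e = a then 1 else 0) - if t e = a then 1 else 0) ≤ 0 := by
      refine Finset.sum_nonpos fun e _ ↦ mul_nonpos_of_nonneg_of_nonpos (hfeas.nonneg e) ?_
      rw [if_neg (ha e)]
      split_ifs <;> simp
    linarith
  rw [← hconst.apply_eq_of_preconnectedSpace 0, zero_smul, add_zero] at hzero
  rw [← ZMod.natCast_eq_zero_iff, ← hzero, extremePoints_flowPolytope hδ hgen,
    Set.InjOn.ncard_image]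
  · simp only [N]
    rw [← Set.ncard_coe_finset]
    congr 2
    ext B
    simp only [Set.mem_ofPred_eq, Finset.coe_filter, Finset.mem_univ, true_and]
    refine and_congr_right fun hB ↦ ⟨fun h e he ↦ Or.inl (h e he), fun h e he ↦ ?_⟩
    have := hB.eq_of_conn (posSupport_subset δ B)
      (conn_of_generic hgen (hB.netFlow_basisFlow hδ) fun e ↦ h.apply_eq_zero)
    exact basisFlow_pos_of_mem (this.superset he)
  · rintro B ⟨-, hB⟩ B' ⟨-, hB'⟩ (h : basisFlow s t B δ = basisFlow s t B' δ)
    ext e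
    constructor <;> intro he <;> by_contra hne
    · exact (hB e he).ne' (by rw [h, basisFlow_apply_of_notMem hne])
    · exact (hB' e he).ne' (by rw [← h, basisFlow_apply_of_notMem hne])

end FlowPolytope

/-- The number of vertices of a generic (non-degenerate) `p × q` classical transportation
polytope is divisible by `gcd p q`. -/
theorem gcd_dvd_ncard_extremePoints_transportationPolytope
    (p q : ℕ) (hp : 1 ≤ p) (hq : 1 ≤ q)
    (u : Fin p → ℝ) (v : Fin q → ℝ)
    (hu : ∀ i, 0 < u i) (hv : ∀ j, 0 < v j)
    (hsum : ∑ i, u i = ∑ j, v j)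
    (hgen : IsGeneric u v) :
    Nat.gcd p q ∣ (Set.extremePoints ℝ (transportationPolytope u v)).ncard := by
  have hpV : Nonempty (Fin p) := ⟨⟨0, hp⟩⟩
  have hqV : Nonempty (Fin q) := ⟨⟨0, hq⟩⟩
  let s : Fin p × Fin q → Fin p ⊕ Fin q := fun e ↦ Sum.inl e.1
  let t : Fin p × Fin q → Fin p ⊕ Fin q := fun e ↦ Sum.inr e.2
  let δ : Fin p ⊕ Fin q → ℝ := Sum.elim u (-v)
  have himage : LinearEquiv.curry ℝ ℝ (Fin p) (Fin q) '' FlowPolytope.flowPolytope s t δ =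
      transportationPolytope u v := by
    rw [LinearEquiv.image_eq_preimage_symm]
    ext x
    have h1 (i : Fin p) (y : Fin p × Fin q → ℝ) :
        FlowPolytope.netFlow s t y (Sum.inl i) = ∑ j, y (i, j) := by
      simp [FlowPolytope.netFlow_apply, s, t, Fintype.sum_prod_type_right]
    have h2 (j : Fin q) (y : Fin p × Fin q → ℝ) :
        FlowPolytope.netFlow s t y (Sum.inr j) = -∑ i, y (i, j) := by
      simp [FlowPolytope.netFlow_apply, s, t, Fintype.sum_prod_type]
    simp [FlowPolytope.flowPolytope, transportationPolytope, funext_iff, h1, h2, δ,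
      Function.uncurry]
  rw [← himage, ← image_extremePoints,
    Set.ncard_image_of_injective _ (LinearEquiv.injective _)]
  refine FlowPolytope.dvd_ncard_extremePoints_flowPolytope (a := Sum.inr ⟨0, hq⟩)
    (b := Sum.inl ⟨0, hp⟩) ?_ ?_ ?_ (by simp) (by simp [s])
  · have hfst (i : Fin p) : ({e | e.1 = i} : Finset (Fin p × Fin q)).card = q := by
      rw [show ({e | e.1 = i} : Finset (Fin p × Fin q)) = {i} ×ˢ Finset.univ by
        ext; simp only [Finset.mem_filter, Finset.mem_product]; simp]
      simp
    have hsnd (j : Fin q) : ({e | e.2 = j} : Finset (Fin p × Fin q)).card = p := by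
      rw [show ({e | e.2 = j} : Finset (Fin p × Fin q)) = Finset.univ ×ˢ {j} by
        ext; simp only [Finset.mem_filter, Finset.mem_product]; simp]
      simp
    rintro (i | j)
    · simp [s, t, hfst, ZMod.natCast_eq_zero_iff, Nat.gcd_dvd_right]
    · simp [s, t, hsnd, eq_comm (a := (0 : ZMod _)), ZMod.natCast_eq_zero_iff, Nat.gcd_dvd_left]
  · simp [δ, hsum]
  · intro X hX0 hX1
    rw [← Finset.toLeft_disjSum_toRight (u := X)] at hX0 hX1 ⊢
    generalize X.toLeft = Y at *
    generalize X.toRight = Z at *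
    rw [Finset.sum_disjSum]
    simp only [δ, Sum.elim_inl, Sum.elim_inr, Pi.neg_apply, Finset.sum_neg_distrib]
    have hposu {Y : Finset (Fin p)} (hY : Y ≠ ∅) : 0 < ∑ i ∈ Y, u i :=
      Finset.sum_pos (fun i _ ↦ hu i) (Finset.nonempty_iff_ne_empty.2 hY)
    have hposv {Z : Finset (Fin q)} (hZ : Z ≠ ∅) : 0 < ∑ j ∈ Z, v j :=
      Finset.sum_pos (fun j _ ↦ hv j) (Finset.nonempty_iff_ne_empty.2 hZ)
    have hsumu := Finset.sum_add_sum_compl Y u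
    have hsumv := Finset.sum_add_sum_compl Z v
    intro h0
    by_cases hY0 : Y = ∅
    · subst hY0
      have := hposv (Z := Z) (by rintro rfl; simp at hX0)
      simp only [Finset.sum_empty] at h0
      linarith
    by_cases hZ0 : Z = ∅
    · subst hZ0
      have := hposu hY0
      simp only [Finset.sum_empty] at h0
      linarith
    by_cases hY1 : Y = Finset.univ
    · subst hY1
      have := hposv (Z := Zᶜ) (by
        rw [Ne, Finset.compl_eq_empty_iff]
        rintro rfl
        simp at hX1)
      linarith
    by_cases hZ1 : Z = Finset.univ
    · subst hZ1
      have := hposu (Y := Yᶜ) (by rwa [Ne, Finset.compl_eq_empty_iff])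
      linarith
    exact hgen Y Z (Finset.nonempty_iff_ne_empty.2 hY0) hY1 (Finset.nonempty_iff_ne_empty.2 hZ0)
      hZ1 (by linarith)
end
end

section
/- (1) For every choice of 2-marginals U : Fin 2 → Fin 2 → ℝ, V : Fin 2 → Fin p → ℝ, W : Fin 2 → Fin p → ℝ, there exist marginals u : Fin p → ℝ and v : Fin 2 → ℝ and an affine map φ : (Fin 2 → Fin 2 → Fin p → ℝ) →ᵃ[ℝ] (Fin p → Fin 2 → ℝ) whose restriction to the planar 2×2×p transportation polytope P(U,V,W) is a bijection onto the classical transportation polytope T(u,v). (2) Conversely, for every u : Fin p → ℝ and v : Fin 2 → ℝ with nonnegative entries there exist 2-marginals U, V, W as above and an affine map ψ : (Fin p → Fin 2 → ℝ) →ᵃ[ℝ] (Fin 2 → Fin 2 → Fin p → ℝ) whose restriction to T(u,v) is a bijection onto P(U,V,W). -/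
open scoped BigOperators

noncomputable section

/-- The planar `2 × 2 × p` transportation polytope defined by the 2-marginals `U`, `V`, `W`. -/
def planar22p {p : ℕ} (U : Fin 2 → Fin 2 → ℝ) (V : Fin 2 → Fin p → ℝ)
    (W : Fin 2 → Fin p → ℝ) : Set (Fin 2 → Fin 2 → Fin p → ℝ) :=
  {x | (∀ i j k, 0 ≤ x i j k) ∧ (∀ i j, ∑ k, x i j k = U i j) ∧
    (∀ i k, ∑ j, x i j k = V i k) ∧ (∀ j k, ∑ i, x i j k = W j k)}

/-- The coordinate `x 0 0 k` recorded with both signs, as a linear map on `2 × 2 × p` arrays. -/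
def cornerLinear (p : ℕ) : (Fin 2 → Fin 2 → Fin p → ℝ) →ₗ[ℝ] (Fin p → Fin 2 → ℝ) where
  toFun x k := ![x 0 0 k, -x 0 0 k]
  map_add' x y := by
    ext k j
    fin_cases j <;> simp [add_comm]
  map_smul' c x := by
    ext k j
    fin_cases j <;> simp

/-- The map sending `y` to the array with equal diagonal entries `y k 0` and equal
off-diagonal entries `y k 1` in the slice `k`. -/
def cyclicLinear (p : ℕ) : (Fin p → Fin 2 → ℝ) →ₗ[ℝ] (Fin 2 → Fin 2 → Fin p → ℝ) where
  toFun y i j k := y k (i + j)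
  map_add' _ _ := rfl
  map_smul' _ _ := rfl

/-- The slack map based at `z`: within a slice with fixed line sums, its two values are the
smallest diagonal and the smallest off-diagonal entry. -/
def slackMap {p : ℕ} (z : Fin 2 → Fin 2 → Fin p → ℝ) :
    (Fin 2 → Fin 2 → Fin p → ℝ) →ᵃ[ℝ] (Fin p → Fin 2 → ℝ) :=
  (cornerLinear p).toAffineMap + AffineMap.const ℝ _ fun k =>
    ![min (z 0 0 k) (z 1 1 k) - z 0 0 k, min (z 0 1 k) (z 1 0 k) + z 0 0 k]

theorem slackMap_apply_zero {p : ℕ} (z x : Fin 2 → Fin 2 → Fin p → ℝ) (k : Fin p) :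
    slackMap z x k 0 = x 0 0 k + (min (z 0 0 k) (z 1 1 k) - z 0 0 k) := by
  simp [slackMap, cornerLinear]

theorem slackMap_apply_one {p : ℕ} (z x : Fin 2 → Fin 2 → Fin p → ℝ) (k : Fin p) :
    slackMap z x k 1 = -x 0 0 k + (min (z 0 1 k) (z 1 0 k) + z 0 0 k) := by
  simp [slackMap, cornerLinear]

theorem bijOn_slackMap {p : ℕ} {U : Fin 2 → Fin 2 → ℝ} {V W : Fin 2 → Fin p → ℝ}
    {z : Fin 2 → Fin 2 → Fin p → ℝ} (hz : z ∈ planar22p U V W) :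
    Set.BijOn (slackMap z) (planar22p U V W)
      (transportationPolytope
        (fun k => min (z 0 0 k) (z 1 1 k) + min (z 0 1 k) (z 1 0 k))
        ![∑ k, min (z 0 0 k) (z 1 1 k), ∑ k, min (z 0 1 k) (z 1 0 k)]) := by
  obtain ⟨-, zU, zV, zW⟩ := hz
  simp only [Fin.sum_univ_two] at zV zW
  refine ⟨?_, ?_, ?_⟩
  · rintro x ⟨x0, xU, xV, xW⟩
    simp only [Fin.sum_univ_two] at xV xW
    refine ⟨fun k j => ?_, fun k => ?_, fun j => ?_⟩
    · fin_cases j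
      · change 0 ≤ slackMap z x k 0
        rw [slackMap_apply_zero]
        rcases min_choice (z 0 0 k) (z 1 1 k) with h | h <;> rw [h] <;>
          linarith [x0 0 0 k, x0 1 1 k, xV 0 k, xW 1 k, zV 0 k, zW 1 k]
      · change 0 ≤ slackMap z x k 1
        rw [slackMap_apply_one]
        rcases min_choice (z 0 1 k) (z 1 0 k) with h | h <;> rw [h] <;>
          linarith [x0 0 1 k, x0 1 0 k, xV 0 k, xW 0 k, zV 0 k, zW 0 k]
    · rw [Fin.sum_univ_two, slackMap_apply_zero, slackMap_apply_one]
      ring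
    · fin_cases j
      · simp [slackMap_apply_zero, Finset.sum_add_distrib, xU, zU]
      · simp [slackMap_apply_one, Finset.sum_add_distrib, xU, zU]
  · rintro x ⟨-, -, xV, xW⟩ y ⟨-, -, yV, yW⟩ hxy
    simp only [Fin.sum_univ_two] at xV xW yV yW
    ext i j k
    have h := congrFun (congrFun hxy k) 0
    rw [slackMap_apply_zero, slackMap_apply_zero] at h
    fin_cases i <;> fin_cases j <;> dsimp <;>
      linarith [xV 0 k, xW 0 k, xW 1 k, yV 0 k, yW 0 k, yW 1 k]
  · rintro y ⟨y0, yu, yv⟩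
    simp only [Fin.sum_univ_two] at yu
    set d : Fin p → ℝ := fun k => y k 0 - min (z 0 0 k) (z 1 1 k) with hd
    have d0 : ∑ k, d k = 0 := by simp [hd, yv]
    refine ⟨fun i j k => if i = j then z i j k + d k else z i j k - d k,
      ⟨fun i j k => ?_, fun i j => ?_, fun i k => ?_, fun j k => ?_⟩, ?_⟩
    · have h1 := min_le_left (z 0 0 k) (z 1 1 k)
      have h2 := min_le_right (z 0 0 k) (z 1 1 k)
      have h3 := min_le_left (z 0 1 k) (z 1 0 k)
      have h4 := min_le_right (z 0 1 k) (z 1 0 k)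
      fin_cases i <;> fin_cases j <;> simp [hd] <;> linarith [y0 k 0, y0 k 1, yu k]
    · dsimp only
      split_ifs <;> simp [Finset.sum_add_distrib, d0, zU]
    · fin_cases i <;> simp [Fin.sum_univ_two, ← zV]
    · fin_cases j <;> simp [Fin.sum_univ_two, ← zW]
    · ext k j
      fin_cases j
      · simp [slackMap_apply_zero, hd]
        ring
      · simp only [Fin.mk_one, slackMap_apply_one, if_true, hd]
        linarith [yu k]

theorem transportationPolytope_eq_empty {p q : ℕ} (u : Fin p → ℝ) {v : Fin q → ℝ} {j : Fin q}
    (hj : v j < 0) : transportationPolytope u v = ∅ := by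
  refine Set.eq_empty_of_forall_notMem fun x hx => hj.not_ge ?_
  rw [← hx.2.2 j]
  exact Finset.sum_nonneg fun i _ => hx.1 i j

theorem bijOn_cyclicLinear {p : ℕ} (u : Fin p → ℝ) (v : Fin 2 → ℝ) :
    Set.BijOn (cyclicLinear p) (transportationPolytope u v)
      (planar22p (fun i j => v (i + j)) (fun _ => u) (fun _ => u)) := by
  refine ⟨?_, ?_, ?_⟩
  · rintro y ⟨y0, yu, yv⟩
    refine ⟨fun i j k => y0 k (i + j), fun i j => yv (i + j), fun i k => ?_, fun j k => ?_⟩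
    · exact (Equiv.sum_comp (Equiv.addLeft i) (y k)).trans (yu k)
    · exact (Equiv.sum_comp (Equiv.addRight j) (y k)).trans (yu k)
  · intro x _ y _ hxy
    ext k j
    simpa [cyclicLinear] using congrFun (congrFun (congrFun hxy 0) j) k
  · rintro x ⟨x0, xU, xV, xW⟩
    refine ⟨fun k j => x 0 j k, ⟨fun k j => x0 0 j k, fun k => xV 0 k, fun j => ?_⟩, ?_⟩
    · simpa using xU 0 j
    · simp only [Fin.sum_univ_two] at xV xW
      ext i j k
      fin_cases i <;> fin_cases j <;> simp [cyclicLinear] <;>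
        linarith [xV 0 k, xW 0 k, xW 1 k]

/-- The planar `2 × 2 × p` transportation polytopes are in bijective (affine) correspondence
with the `p × 2` classical transportation polytopes. -/
theorem planar22p_equiv_transportationPolytope (p : ℕ) :
    (∀ (U : Fin 2 → Fin 2 → ℝ) (V : Fin 2 → Fin p → ℝ) (W : Fin 2 → Fin p → ℝ),
      ∃ (u : Fin p → ℝ) (v : Fin 2 → ℝ)
        (φ : (Fin 2 → Fin 2 → Fin p → ℝ) →ᵃ[ℝ] (Fin p → Fin 2 → ℝ)),
        Set.BijOn φ (planar22p U V W) (transportationPolytope u v)) ∧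
    (∀ (u : Fin p → ℝ) (v : Fin 2 → ℝ), (∀ i, 0 ≤ u i) → (∀ j, 0 ≤ v j) →
      ∃ (U : Fin 2 → Fin 2 → ℝ) (V : Fin 2 → Fin p → ℝ) (W : Fin 2 → Fin p → ℝ)
        (ψ : (Fin p → Fin 2 → ℝ) →ᵃ[ℝ] (Fin 2 → Fin 2 → Fin p → ℝ)),
        Set.BijOn ψ (transportationPolytope u v) (planar22p U V W)) := by
  refine ⟨fun U V W => ?_, fun u v _ _ => ?_⟩
  · rcases (planar22p U V W).eq_empty_or_nonempty with h | ⟨z, hz⟩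
    · refine ⟨0, fun _ => -1, 0, ?_⟩
      rw [h, transportationPolytope_eq_empty 0 (j := 0) (by norm_num)]
      exact Set.bijOn_empty _
    · exact ⟨_, _, slackMap z, bijOn_slackMap hz⟩
  · exact ⟨_, _, _, (cyclicLinear p).toAffineMap, bijOn_cyclicLinear u v⟩
end
end

section
/- Let p, q ≥ 1, let u : Fin p → ℝ, v : Fin q → ℝ, and W : Fin p → Fin q → ℝ. Define U : Fin 2 → Fin p → ℝ by U 0 = u and U 1 j = (∑_k W j k) − u j, and V : Fin 2 → Fin q → ℝ by V 0 = v and V 1 k = (∑_j W j k) − v k. Then the coordinate projection x ↦ x 0 restricts to a bijection from the planar 2×p×q transportation polytope P(U,V,W) onto the capacitated transportation polytope Q = { y : Fin p → Fin q → ℝ | 0 ≤ y j k ≤ W j k for all j k, ∑_k y j k = u j for all j, and ∑_j y j k = v k for all k }. -/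
open scoped BigOperators

noncomputable section

/-- The planar `2 × p × q` transportation polytope defined by the 2-marginals `U`, `V`, `W`. -/
def planar2pq {p q : ℕ} (U : Fin 2 → Fin p → ℝ) (V : Fin 2 → Fin q → ℝ)
    (W : Fin p → Fin q → ℝ) : Set (Fin 2 → Fin p → Fin q → ℝ) :=
  {x | (∀ i j k, 0 ≤ x i j k) ∧ (∀ i j, ∑ k, x i j k = U i j) ∧
    (∀ i k, ∑ j, x i j k = V i k) ∧ (∀ j k, ∑ i, x i j k = W j k)}

/-- Planar `2 × p × q` transportation polytopes are exactly the `p × q` transportation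
polytopes with bounded entries: the projection `x ↦ x 0` is a bijection from
`P(U,V,W)` onto the capacitated transportation polytope `Q`. -/
theorem planar2pq_bijOn_capacitated
    (p q : ℕ) (hp : 1 ≤ p) (hq : 1 ≤ q)
    (u : Fin p → ℝ) (v : Fin q → ℝ) (W : Fin p → Fin q → ℝ)
    (U : Fin 2 → Fin p → ℝ) (V : Fin 2 → Fin q → ℝ)
    (hU0 : U 0 = u) (hU1 : ∀ j, U 1 j = (∑ k, W j k) - u j)
    (hV0 : V 0 = v) (hV1 : ∀ k, V 1 k = (∑ j, W j k) - v k) :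
    Set.BijOn (fun x : Fin 2 → Fin p → Fin q → ℝ => x 0)
      (planar2pq U V W)
      {y : Fin p → Fin q → ℝ |
        (∀ j k, 0 ≤ y j k ∧ y j k ≤ W j k) ∧
        (∀ j, ∑ k, y j k = u j) ∧ (∀ k, ∑ j, y j k = v k)} := by
  simp only [planar2pq, Fin.sum_univ_two]
  refine ⟨?_, ?_, ?_⟩
  · rintro x ⟨hx, hxU, hxV, hxW⟩
    refine ⟨fun j k => ⟨hx 0 j k, ?_⟩, fun j => ?_, fun k => ?_⟩
    · linarith [hx 1 j k, hxW j k]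
    · rw [hxU, hU0]
    · rw [hxV, hV0]
  · rintro x ⟨-, -, -, hxW⟩ y ⟨-, -, -, hyW⟩ hxy
    have h0 (j : Fin p) (k : Fin q) : x 0 j k = y 0 j k := congrFun (congrFun hxy j) k
    ext i j k
    fin_cases i
    · exact h0 j k
    · change x 1 j k = y 1 j k
      linarith [h0 j k, hxW j k, hyW j k]
  · rintro y ⟨hy, hyu, hyv⟩
    refine ⟨![y, fun j k => W j k - y j k], ⟨?_, ?_, ?_, ?_⟩, rfl⟩
    · simp [Fin.forall_fin_two, hy]
    · simp [Fin.forall_fin_two, hU0, hU1, hyu]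
    · simp [Fin.forall_fin_two, hV0, hV1, hyv]
    · simp
end
end

section
/- Let p, q, s ≥ 1 and let u : Fin p → ℝ, v : Fin q → ℝ, w : Fin s → ℝ have nonnegative entries. Then for any two extreme points a and b of the 3-way axial transportation polytope A(u,v,w), there is a path from a to b in the graph G(A(u,v,w)) of length at most 2·(p+q+s−2)². -/
open scoped BigOperators

noncomputable section

/-- The 3-way axial `p × q × s` transportation polytope defined by the 1-marginals
`u`, `v`, `w`. -/
def axialPolytope {p q s : ℕ} (u : Fin p → ℝ) (v : Fin q → ℝ) (w : Fin s → ℝ) :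
    Set (Fin p → Fin q → Fin s → ℝ) :=
  {x | (∀ i j k, 0 ≤ x i j k) ∧ (∀ i, ∑ j, ∑ k, x i j k = u i) ∧
    (∀ j, ∑ i, ∑ k, x i j k = v j) ∧ (∀ k, ∑ i, ∑ j, x i j k = w k)}

/-- Adjacency in the graph of a convex set `P`: two distinct extreme points whose closed
segment is a face of `P`. -/
def PolyAdj {E : Type*} [AddCommGroup E] [Module ℝ E] (P : Set E) (a b : E) : Prop :=
  a ≠ b ∧ a ∈ Set.extremePoints ℝ P ∧ b ∈ Set.extremePoints ℝ P ∧
    IsExtreme ℝ P (segment ℝ a b)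

/-- A path of length `L` in the graph of `P` from `a` to `b`. -/
def HasPathOfLength {E : Type*} [AddCommGroup E] [Module ℝ E] (P : Set E) (a b : E)
    (L : ℕ) : Prop :=
  ∃ f : ℕ → E, f 0 = a ∧ f L = b ∧ ∀ i < L, PolyAdj P (f i) (f (i + 1))

section Paths

variable {E F : Type*} [AddCommGroup E] [Module ℝ E] [AddCommGroup F] [Module ℝ F]

lemma PolyAdj.symm {P : Set E} {a b : E} (h : PolyAdj P a b) : PolyAdj P b a :=
  ⟨h.1.symm, h.2.2.1, h.2.1, segment_symm ℝ a b ▸ h.2.2.2⟩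

lemma HasPathOfLength.refl (P : Set E) (a : E) : HasPathOfLength P a a 0 :=
  ⟨fun _ => a, rfl, rfl, fun _ hi => absurd hi (Nat.not_lt_zero _)⟩

lemma PolyAdj.hasPathOfLength {P : Set E} {a b : E} (h : PolyAdj P a b) :
    HasPathOfLength P a b 1 := by
  refine ⟨fun i => if i = 0 then a else b, by simp, by simp, fun i hi => ?_⟩
  obtain rfl : i = 0 := by omega
  simpa using h

lemma HasPathOfLength.trans {P : Set E} {a b c : E} {L M : ℕ}
    (h₁ : HasPathOfLength P a b L) (h₂ : HasPathOfLength P b c M) :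
    HasPathOfLength P a c (L + M) := by
  obtain ⟨f, hf0, hfL, hf⟩ := h₁
  obtain ⟨g, hg0, hgM, hg⟩ := h₂
  refine ⟨fun i => if i ≤ L then f i else g (i - L), by simpa using hf0, ?_, fun i hi => ?_⟩
  · rcases Nat.eq_zero_or_pos M with rfl | hM
    · simp [hfL, ← hgM, hg0]
    · simp [show ¬ M = 0 by omega, hgM]
  · rcases lt_trichotomy i L with h | rfl | h
    · simpa [h.le, Nat.succ_le_of_lt h] using hf i h
    · simpa [hfL, ← hg0] using hg 0 (by omega)
    · have : i + 1 - L = i - L + 1 := by omega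
      simpa [show ¬ i ≤ L by omega, show ¬ i + 1 ≤ L by omega, this] using hg (i - L) (by omega)

lemma HasPathOfLength.symm {P : Set E} {a b : E} {L : ℕ} (h : HasPathOfLength P a b L) :
    HasPathOfLength P b a L := by
  obtain ⟨f, hf0, hfL, hf⟩ := h
  refine ⟨fun i => f (L - i), by simpa using hfL, by simpa using hf0, fun i hi => ?_⟩
  have := (hf (L - (i + 1)) (by omega)).symm
  rwa [show L - (i + 1) + 1 = L - i by omega] at this

lemma IsExtreme.image_affineEquiv {P S : Set E} (h : IsExtreme ℝ P S) (f : E ≃ᵃ[ℝ] F) :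
    IsExtreme ℝ (f '' P) (f '' S) := by
  refine ⟨Set.image_mono h.1, ?_⟩
  rintro _ ⟨x, hx, rfl⟩ _ ⟨y, hy, rfl⟩ _ ⟨z, hz, rfl⟩ hxy
  have key := image_openSegment ℝ f.toAffineMap x y
  simp only [AffineEquiv.coe_toAffineMap] at key
  rw [← key, f.injective.mem_set_image] at hxy
  exact ⟨x, h.2 hx hy hz hxy, rfl⟩

lemma mem_extremePoints_image_affineEquiv {P : Set E} {a : E} (h : a ∈ Set.extremePoints ℝ P)
    (f : E ≃ᵃ[ℝ] F) : f a ∈ Set.extremePoints ℝ (f '' P) := by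
  rw [← isExtreme_singleton] at h ⊢
  simpa using h.image_affineEquiv f

lemma HasPathOfLength.image {P : Set E} {Q : Set F} (f : E ≃ᵃ[ℝ] F)
    (hQ : IsExtreme ℝ Q (f '' P)) {a b : E} {L : ℕ} (h : HasPathOfLength P a b L) :
    HasPathOfLength Q (f a) (f b) L := by
  obtain ⟨g, hg0, hgL, hg⟩ := h
  refine ⟨fun i => f (g i), by simp [hg0], by simp [hgL], fun i hi => ?_⟩
  obtain ⟨hne, hx, hy, hseg⟩ := hg i hi
  refine ⟨f.injective.ne hne,
    hQ.extremePoints_subset_extremePoints (mem_extremePoints_image_affineEquiv hx f),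
    hQ.extremePoints_subset_extremePoints (mem_extremePoints_image_affineEquiv hy f), ?_⟩
  have key := image_segment ℝ f.toAffineMap (g i) (g (i + 1))
  simp only [AffineEquiv.coe_toAffineMap] at key
  exact key ▸ hQ.trans (hseg.image_affineEquiv f)

end Paths

section Polytope

variable {C W : Type*} [Fintype C] [AddCommGroup W] [Module ℝ W]

/-- The polyhedron of nonnegative solutions of `A x = b`. -/
def standardPolyhedron (A : (C → ℝ) →ₗ[ℝ] W) (b : W) : Set (C → ℝ) :=
  {x | (∀ c, 0 ≤ x c) ∧ A x = b}

/-- The vectors of the kernel of `A` that are supported on `Z`. -/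
def kerOn (A : (C → ℝ) →ₗ[ℝ] W) (Z : Set C) : Submodule ℝ (C → ℝ) where
  carrier := {d | A d = 0 ∧ ∀ c ∉ Z, d c = 0}
  zero_mem' := by simp
  add_mem' := by
    rintro d e ⟨hd, hd'⟩ ⟨he, he'⟩
    exact ⟨by simp [hd, he], fun c hc => by simp [hd' c hc, he' c hc]⟩
  smul_mem' := by
    rintro r d ⟨hd, hd'⟩
    exact ⟨by simp [hd], fun c hc => by simp [hd' c hc]⟩

variable {A : (C → ℝ) →ₗ[ℝ] W} {b : W}

omit [Fintype C] in
lemma kerOn_mono {Z Z' : Set C} (h : Z ⊆ Z') : kerOn A Z ≤ kerOn A Z' :=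
  fun _ hd => ⟨hd.1, fun c hc => hd.2 c fun hcZ => hc (h hcZ)⟩

omit [Fintype C] in
lemma isExtreme_standardPolyhedron_support (Z : Set C) :
    IsExtreme ℝ (standardPolyhedron A b) {x ∈ standardPolyhedron A b | ∀ c ∉ Z, x c = 0} := by
  refine ⟨fun x hx => hx.1, ?_⟩
  rintro x hx y hy z ⟨-, hz⟩ ⟨r, s, hr, hs, -, rfl⟩
  refine ⟨hx, fun c hc => ?_⟩
  have h := hz c hc
  simp only [Pi.add_apply, Pi.smul_apply, smul_eq_mul] at h
  have h1 := mul_nonneg hr.le (hx.1 c)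
  have h2 := mul_nonneg hs.le (hy.1 c)
  have : r * x c = 0 := by linarith
  exact (mul_eq_zero.1 this).resolve_left hr.ne'

lemma exists_ratio_test {x d : C → ℝ} (hx : ∀ c, 0 ≤ x c) (hd : ∀ c, x c = 0 → 0 ≤ d c)
    (hneg : ∃ c, d c < 0) :
    ∃ t : ℝ, 0 < t ∧ (∀ c, 0 ≤ x c + t * d c) ∧ ∃ c, d c < 0 ∧ x c + t * d c = 0 := by
  classical
  obtain ⟨c₀, hc₀⟩ := hneg
  obtain ⟨m, hm, hmin⟩ := Finset.exists_min_image {c | d c < 0} (fun c => x c / -d c)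
    ⟨c₀, by simpa using hc₀⟩
  simp only [Finset.mem_filter, Finset.mem_univ, true_and] at hm hmin
  have hxm : 0 < x m := lt_of_le_of_ne (hx m) fun h => (hd m h.symm).not_gt hm
  have ht : 0 < x m / -d m := div_pos hxm (by linarith)
  refine ⟨x m / -d m, ht, fun c => ?_, m, hm, ?_⟩
  · rcases lt_or_ge (d c) 0 with h | h
    · have := hmin c h
      rw [le_div_iff₀ (by linarith)] at this
      linarith
    · have := mul_nonneg ht.le h
      linarith [hx c]
  · field_simp [hm.ne]
    ring

/-- Nonnegative kernel vectors vanish, so every polyhedron `standardPolyhedron A b` is bounded. -/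
def KerPointed (A : (C → ℝ) →ₗ[ℝ] W) : Prop :=
  ∀ d, A d = 0 → (∀ c, 0 ≤ d c) → d = 0

lemma KerPointed.exists_neg (hA : KerPointed A) {d : C → ℝ} (hd : A d = 0) (hne : d ≠ 0) :
    ∃ c, d c < 0 := by
  by_contra! h
  exact hne (hA d hd h)

lemma kerOn_support_eq_bot (hA : KerPointed A) {x : C → ℝ}
    (hx : x ∈ Set.extremePoints ℝ (standardPolyhedron A b)) :
    kerOn A (Function.support x) = ⊥ := by
  rw [eq_bot_iff]
  rintro d ⟨hd, hd0⟩
  rw [Submodule.mem_bot]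
  by_contra hne
  have hd0' : ∀ c, x c = 0 → d c = 0 := fun c hc => hd0 c (by simpa using hc)
  obtain ⟨t, ht, hpos, -⟩ := exists_ratio_test hx.1.1 (fun c hc => (hd0' c hc).ge)
    (hA.exists_neg hd hne)
  obtain ⟨r, hr, hpos', -⟩ := exists_ratio_test (d := -d) hx.1.1
    (fun c hc => by simp [hd0' c hc]) (hA.exists_neg (by simp [hd]) (neg_ne_zero.2 hne))
  have key := hx.2 (x₁ := x + t • d) ⟨by simpa using hpos, by simp [hd, hx.1.2]⟩
    (x₂ := x + r • -d) ⟨by simpa using hpos', by simp [hd, hx.1.2]⟩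
    ⟨r / (t + r), t / (t + r), by positivity, by positivity, by field_simp; ring, by
      ext c
      simp
      field_simp
      ring⟩
  have : t • d = 0 := by simpa using key
  exact (smul_eq_zero.1 this).elim ht.ne' hne

omit [Fintype C] in
lemma mem_extremePoints_of_kerOn_support {x : C → ℝ} (hx : x ∈ standardPolyhedron A b)
    (h : kerOn A (Function.support x) = ⊥) :
    x ∈ Set.extremePoints ℝ (standardPolyhedron A b) := by
  rw [← isExtreme_singleton]
  convert! isExtreme_standardPolyhedron_support (A := A) (b := b) (Function.support x) using 1
  ext z
  constructor
  · rintro rfl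
    exact ⟨hx, fun c hc => by simpa using hc⟩
  · rintro ⟨hz, hz0⟩
    have : z - x ∈ kerOn A (Function.support x) :=
      ⟨by simp [hz.2, hx.2], fun c hc => by simp [hz0 c hc, Function.notMem_support.1 hc]⟩
    rw [h, Submodule.mem_bot, sub_eq_zero] at this
    exact this

/-- A feasible direction at a vertex that increases the coordinate `h` can be replaced by the
direction of an edge with the same property. -/
lemma exists_edge_direction (hA : KerPointed A) {x : C → ℝ}
    (hx : x ∈ Set.extremePoints ℝ (standardPolyhedron A b)) {Z : Set C}
    (hxZ : ∀ c ∉ Z, x c = 0) {h : C} {d : C → ℝ}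
    (hd : d ∈ kerOn A Z) (hfeas : ∀ c, x c = 0 → 0 ≤ d c) (hh : 0 < d h) :
    ∃ e ∈ kerOn A Z, (∀ c, x c = 0 → 0 ≤ e c) ∧ 0 < e h ∧
      ∀ g ∈ kerOn A (Function.support x ∪ Function.support e), g h = 0 → g = 0 := by
  classical
  let n : (C → ℝ) → ℕ := fun e => (Finset.univ.filter fun c => x c = 0 ∧ e c ≠ 0).card
  obtain ⟨e, ⟨heZ, hefeas, heh⟩, hmin⟩ := exists_minimalFor_of_wellFoundedLT
    (fun e : C → ℝ => e ∈ kerOn A Z ∧ (∀ c, x c = 0 → 0 ≤ e c) ∧ 0 < e h) n ⟨d, hd, hfeas, hh⟩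
  refine ⟨e, heZ, hefeas, heh, fun g hg hgh => ?_⟩
  have hshrink : ∀ f ∈ kerOn A (Function.support x ∪ Function.support e), f h = 0 →
      ∀ c, x c = 0 → 0 ≤ f c := by
    intro f hf hfh c₁ hc₁
    by_contra! hfc₁
    have hf0 : ∀ c, x c = 0 → e c = 0 → f c = 0 := fun c h1 h2 => hf.2 c (by simp [h1, h2])
    obtain ⟨t, -, hpos, c₂, hc₂, hc₂'⟩ := exists_ratio_test
      (x := fun c => if x c = 0 then e c else 0) (d := fun c => if x c = 0 then f c else 0)
      (fun c => by split_ifs with hc; exacts [hefeas c hc, le_rfl])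
      (fun c hc => by
        split_ifs with hxc
        · rw [if_pos hxc] at hc
          exact (hf0 c hxc hc).ge
        · exact le_rfl)
      ⟨c₁, by simpa [hc₁] using hfc₁⟩
    have hxc₂ : x c₂ = 0 := by
      by_contra hne
      simp [hne] at hc₂
    simp only [hxc₂, if_true] at hc₂ hc₂'
    have hec₂ : e c₂ ≠ 0 := fun h0 => hc₂.ne (hf0 c₂ hxc₂ h0)
    have hmem : e + t • f ∈ kerOn A Z := by
      refine ⟨by simp [heZ.1, hf.1], fun c hc => ?_⟩
      simp [heZ.2 c hc, hf0 c (hxZ c hc) (heZ.2 c hc)]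
    refine (Nat.lt_irrefl _) ((Finset.card_lt_card ?_).trans_le
      (hmin (j := e + t • f) ⟨hmem, fun c hc => ?_, by simpa [hfh] using heh⟩
        (Finset.card_le_card ?_)))
    · rw [Finset.ssubset_iff_of_subset]
      · exact ⟨c₂, by simp [hxc₂, hec₂], by simp [hc₂']⟩
      · intro c
        simp only [Finset.mem_filter, Finset.mem_univ, true_and, Pi.add_apply, Pi.smul_apply]
        exact fun ⟨h1, h2⟩ => ⟨h1, fun h3 => h2 (by simp [h3, hf0 c h1 h3])⟩
    · simpa [hc] using hpos c
    · intro c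
      simp only [Finset.mem_filter, Finset.mem_univ, true_and, Pi.add_apply, Pi.smul_apply]
      exact fun ⟨h1, h2⟩ => ⟨h1, fun h3 => h2 (by simp [h3, hf0 c h1 h3])⟩
  have hgx : g ∈ kerOn A (Function.support x) := by
    refine ⟨hg.1, fun c hc => le_antisymm ?_ (hshrink g hg hgh c (by simpa using hc))⟩
    simpa using hshrink (-g) (neg_mem hg) (by simp [hgh]) c (by simpa using hc)
  rwa [kerOn_support_eq_bot hA hx, Submodule.mem_bot] at hgx

lemma exists_pivot (hA : KerPointed A) {x : C → ℝ}
    (hx : x ∈ Set.extremePoints ℝ (standardPolyhedron A b)) {Z : Set C}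
    (hxZ : ∀ c ∉ Z, x c = 0) {h : C} {d : C → ℝ}
    (hd : d ∈ kerOn A Z) (hfeas : ∀ c, x c = 0 → 0 ≤ d c) (hh : 0 < d h) :
    ∃ e ∈ kerOn A Z, ∃ t : ℝ, 0 < t ∧ 0 < e h ∧
      PolyAdj (standardPolyhedron A b) x (x + t • e) ∧ ∃ c, e c < 0 ∧ x c + t * e c = 0 := by
  obtain ⟨e, heZ, hefeas, heh, huniq⟩ := exists_edge_direction hA hx hxZ hd hfeas hh
  have he0 : e ≠ 0 := fun h0 => by simp [h0] at heh
  obtain ⟨t, ht, hpos, c₀, hc₀, hc₀'⟩ := exists_ratio_test hx.1.1 hefeas (hA.exists_neg heZ.1 he0)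
  set Z' := Function.support x ∪ Function.support e with hZ'
  have heZ' : e ∈ kerOn A Z' := ⟨heZ.1, fun c hc => by simp [hZ'] at hc; exact hc.2⟩
  have hline : ∀ g ∈ kerOn A Z', ∃ r : ℝ, g = r • e := fun g hg =>
    ⟨g h / e h, sub_eq_zero.1 (huniq _ (sub_mem hg (Submodule.smul_mem _ _ heZ'))
      (by simp [heh.ne']))⟩
  have hyP : x + t • e ∈ standardPolyhedron A b :=
    ⟨by simpa using hpos, by simp [heZ.1, hx.1.2]⟩
  obtain ⟨c₁, hxc₁, hec₁⟩ : ∃ c, x c = 0 ∧ 0 < e c := by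
    by_contra! hcon
    have : e ∈ kerOn A (Function.support x) := ⟨heZ.1, fun c hc =>
      le_antisymm (hcon c (by simpa using hc)) (hefeas c (by simpa using hc))⟩
    rw [kerOn_support_eq_bot hA hx, Submodule.mem_bot] at this
    exact he0 this
  have hy : x + t • e ∈ Set.extremePoints ℝ (standardPolyhedron A b) := by
    refine mem_extremePoints_of_kerOn_support hyP ?_
    rw [eq_bot_iff]
    intro g hg
    have hgZ' : g ∈ kerOn A Z' := by
      refine kerOn_mono (fun c hc => ?_) hg
      by_contra hcZ
      simp only [hZ', Set.mem_union, Function.mem_support, not_or, not_not] at hcZ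
      simp [hcZ] at hc
    obtain ⟨r, rfl⟩ := hline g hgZ'
    have : r * e c₀ = 0 := by simpa using hg.2 c₀ (by simpa using hc₀')
    simp [(mul_eq_zero.1 this).resolve_right hc₀.ne]
  refine ⟨e, heZ, t, ht, heh, ⟨?_, hx, hy, ?_⟩, c₀, hc₀, hc₀'⟩
  · simpa using ⟨ht.ne', he0⟩
  · convert! isExtreme_standardPolyhedron_support (A := A) (b := b) Z' using 1
    ext z
    rw [segment_eq_image']
    constructor
    · rintro ⟨r, ⟨hr0, hr1⟩, rfl⟩
      refine ⟨⟨fun c => ?_, by simp [heZ.1, hx.1.2]⟩, fun c hc => ?_⟩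
      · have h1 := mul_nonneg hr0 (hpos c)
        have h2 := mul_nonneg (sub_nonneg.2 hr1) (hx.1.1 c)
        simp
        linarith
      · simp [hZ'] at hc
        simp [hc]
    · rintro ⟨hz, hz0⟩
      obtain ⟨r, hr⟩ := hline (z - x) ⟨by simp [hz.2, hx.1.2], fun c hc => by
        have := hz0 c hc
        simp [hZ'] at hc
        simp [hc, this]⟩
      obtain rfl : z = x + r • e := by rw [← hr]; abel
      have h0 : 0 ≤ r := by
        have := hz.1 c₁
        simp only [Pi.add_apply, Pi.smul_apply, hxc₁, zero_add, smul_eq_mul] at this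
        exact nonneg_of_mul_nonneg_left this hec₁
      have h1 : r ≤ t := by
        have := hz.1 c₀
        simp only [Pi.add_apply, Pi.smul_apply, smul_eq_mul] at this
        nlinarith
      refine ⟨r / t, ⟨by positivity, (div_le_one ht).2 h1⟩, ?_⟩
      ext c
      simp
      field_simp

/-- A vector supported off a vertex by few coordinates lies in a kernel of small dimension. -/
lemma finrank_kerOn_le (hA : KerPointed A) {x : C → ℝ}
    (hx : x ∈ Set.extremePoints ℝ (standardPolyhedron A b)) {Z : Set C} (T : Finset C)
    (hZ : ∀ c ∈ Z, x c = 0 → c ∈ T) :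
    Module.finrank ℝ (kerOn A Z) ≤ T.card := by
  have := LinearMap.finrank_le_finrank_of_injective
    (f := (LinearMap.funLeft ℝ ℝ (Subtype.val : T → C)).comp (kerOn A Z).subtype) (by
      rw [injective_iff_map_eq_zero]
      intro g hg
      have hgx : (g : C → ℝ) ∈ kerOn A (Function.support x) := by
        refine ⟨g.2.1, fun c hc => ?_⟩
        by_cases hcZ : c ∈ Z
        · exact congrFun hg ⟨c, hZ c hcZ (by simpa using hc)⟩
        · exact g.2.2 c hcZ
      rw [kerOn_support_eq_bot hA hx, Submodule.mem_bot] at hgx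
      exact Subtype.ext hgx)
  simpa using this

lemma exists_smul_eq_of_finrank_kerOn_le_one {Z : Set C}
    (hdim : Module.finrank ℝ (kerOn A Z) ≤ 1) {d e : C → ℝ} (hd : d ∈ kerOn A Z)
    (he : e ∈ kerOn A Z) (hne : d ≠ 0) : ∃ r : ℝ, e = r • d := by
  obtain ⟨⟨v, hv⟩, hspan⟩ := finrank_le_one_iff.1 hdim
  obtain ⟨r, hr⟩ := hspan ⟨d, hd⟩
  obtain ⟨s, hs⟩ := hspan ⟨e, he⟩
  simp only [SetLike.mk_smul_mk, Subtype.mk.injEq] at hr hs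
  have hr0 : r ≠ 0 := by
    rintro rfl
    exact hne (by simp [← hr])
  exact ⟨s / r, by rw [← hs, ← hr, smul_smul, div_mul_cancel₀ _ hr0]⟩

/-- If the face spanned by a vertex and a feasible direction `d` is an edge, one step along the
edge annihilates a coordinate on which `d` is negative. -/
lemma exists_path_of_finrank_le_one (hA : KerPointed A) {x : C → ℝ}
    (hx : x ∈ Set.extremePoints ℝ (standardPolyhedron A b)) {h : C} {d : C → ℝ}
    (hd : A d = 0) (hfeas : ∀ c, x c = 0 → 0 ≤ d c) (hh : 0 < d h)
    (hdim : Module.finrank ℝ (kerOn A (Function.support x ∪ Function.support d)) ≤ 1) :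
    ∃ y, PolyAdj (standardPolyhedron A b) x y ∧ (∀ c, x c = 0 → d c = 0 → y c = 0) ∧ 0 < y h ∧
      ∃ c, d c < 0 ∧ y c = 0 := by
  have hdZ : d ∈ kerOn A (Function.support x ∪ Function.support d) :=
    ⟨hd, fun c hc => by simp at hc; exact hc.2⟩
  obtain ⟨e, he, t, ht, heh, hadj, c, hec, hc⟩ := exists_pivot hA hx
    (Z := Function.support x ∪ Function.support d) (fun c hc => by simp at hc; exact hc.1)
    hdZ hfeas hh
  obtain ⟨r, rfl⟩ := exists_smul_eq_of_finrank_kerOn_le_one hdim hdZ he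
    (fun h0 => by simp [h0] at hh)
  have hr : 0 < r := pos_of_mul_pos_left (by simpa using heh) hh.le
  refine ⟨_, hadj, fun c h1 h2 => by simp [h1, h2], ?_, c, ?_, by simpa using hc⟩
  · have := mul_pos ht heh
    simpa using add_pos_of_nonneg_of_pos (hx.1.1 h) this
  · exact neg_of_mul_neg_right (by simpa using hec) hr.le

/-- The cost of moving along a feasible direction that increases a coordinate `h` in the support
of the vertex, and at most two other coordinates, until some decreasing coordinate vanishes. -/
lemma exists_path_of_pos (hA : KerPointed A) {x : C → ℝ}
    (hx : x ∈ Set.extremePoints ℝ (standardPolyhedron A b)) {h : C} {d : C → ℝ}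
    (hd : A d = 0) (hfeas : ∀ c, d c < 0 → 0 < x c) (hh : 0 < d h) (hxh : 0 < x h)
    (T : Finset C) (hT : ∀ c, 0 < d c → c ≠ h → c ∈ T) (hT2 : T.card ≤ 2) :
    ∃ y, ∃ L ≤ T.card, HasPathOfLength (standardPolyhedron A b) x y L ∧
      y ∈ Set.extremePoints ℝ (standardPolyhedron A b) ∧
      (∀ c, x c = 0 → d c = 0 → y c = 0) ∧ 0 < y h ∧ ∃ c, d c < 0 ∧ y c = 0 := by
  classical
  have hfeas' : ∀ c, x c = 0 → 0 ≤ d c := fun c hc => by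
    by_contra! hneg
    exact (hfeas c hneg).ne' hc
  have hoff : ∀ c ∈ Function.support x ∪ Function.support d, x c = 0 →
      c ∈ T.filter fun c => x c = 0 := by
    intro c hc hxc
    have hdc : d c ≠ 0 := by simpa [hxc] using hc
    simp only [Finset.mem_filter, hxc, and_true]
    exact hT c (lt_of_le_of_ne (hfeas' c hxc) hdc.symm) fun hch => hxh.ne' (hch ▸ hxc)
  have hrank := finrank_kerOn_le hA hx _ hoff
  have hcard := Finset.card_filter_le T fun c => x c = 0
  have hdZ : d ∈ kerOn A (Function.support x ∪ Function.support d) :=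
    ⟨hd, fun c hc => by simp at hc; exact hc.2⟩
  have hTpos : 1 ≤ T.card := by
    by_contra! h0
    have : Module.finrank ℝ (kerOn A (Function.support x ∪ Function.support d)) = 0 := by omega
    rw [Submodule.finrank_eq_zero] at this
    rw [this, Submodule.mem_bot] at hdZ
    simp [hdZ] at hh
  by_cases hdim : Module.finrank ℝ (kerOn A (Function.support x ∪ Function.support d)) ≤ 1
  · obtain ⟨y, hadj, hy⟩ := exists_path_of_finrank_le_one hA hx hd hfeas' hh hdim
    exact ⟨y, 1, hTpos, hadj.hasPathOfLength, hadj.2.2.1, hy⟩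
  have hTx : ∀ c ∈ T, x c = 0 :=
    Finset.filter_eq_self.1 (Finset.eq_of_subset_of_card_le (Finset.filter_subset _ _) (by omega))
  obtain ⟨e, he, t, ht, heh, hadj, c₀, hec, hc⟩ := exists_pivot hA hx
    (Z := Function.support x ∪ Function.support d) (fun c hc => by simp at hc; exact hc.1)
    hdZ hfeas' hh
  have hsupp : ∀ c, x c = 0 → d c = 0 → (x + t • e) c = 0 := fun c h1 h2 => by
    simp [h1, he.2 c (by simp [h1, h2])]
  have hyh : 0 < (x + t • e) h := by simpa using add_pos hxh (mul_pos ht heh)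
  by_cases hdc : ∃ c, d c < 0 ∧ (x + t • e) c = 0
  · exact ⟨_, 1, hTpos, hadj.hasPathOfLength, hadj.2.2.1, hsupp, hyh, hdc⟩
  push Not at hdc
  have hy := hadj.2.2.1
  have hfeasy : ∀ c, (x + t • e) c = 0 → 0 ≤ d c := fun c hc => by
    by_contra! hneg
    exact hdc c hneg hc
  have hxc₀ : x c₀ ≠ 0 := fun h0 => by
    rw [h0, zero_add] at hc
    exact (mul_neg_of_pos_of_neg ht hec).ne hc
  have hdc₀ : d c₀ = 0 := by
    rcases lt_trichotomy (d c₀) 0 with h1 | h1 | h1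
    · exact absurd (by simpa using hc) (hdc c₀ h1)
    · exact h1
    · refine absurd (hTx c₀ (hT c₀ h1 ?_)) hxc₀
      rintro rfl
      exact hec.not_gt heh
  have hlt : kerOn A (Function.support (x + t • e) ∪ Function.support d) <
      kerOn A (Function.support x ∪ Function.support d) := by
    refine lt_of_le_of_ne (kerOn_mono fun c hc => ?_) fun heq => ?_
    · by_contra hcon
      simp only [Set.mem_union, Function.mem_support, not_or, not_not] at hcon
      rcases hc with hc | hc
      · exact hc (hsupp c hcon.1 hcon.2)
      · exact hc hcon.2
    · rw [← heq] at he
      exact hec.ne (he.2 c₀ (by simp [hdc₀]; exact hc))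
  have hrk := Submodule.finrank_lt_finrank_of_lt hlt
  obtain ⟨z, hadj', hzsupp, hz⟩ := exists_path_of_finrank_le_one hA hy hd hfeasy hh (by omega)
  exact ⟨z, 1 + 1, by omega, hadj.hasPathOfLength.trans hadj'.hasPathOfLength, hadj'.2.2.1,
    fun c h1 h2 => hzsupp c (hsupp c h1 h2) h2, hz⟩

lemma exists_path_of_feasible_direction (hA : KerPointed A) {x : C → ℝ}
    (hx : x ∈ Set.extremePoints ℝ (standardPolyhedron A b)) {h : C} {d : C → ℝ}
    (hd : A d = 0) (hfeas : ∀ c, d c < 0 → 0 < x c) (hh : 0 < d h)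
    (T : Finset C) (hT : ∀ c, 0 < d c → c ≠ h → c ∈ T) (hT2 : T.card ≤ 2) :
    ∃ y, ∃ L ≤ T.card + (if x h = 0 then 1 else 0),
      HasPathOfLength (standardPolyhedron A b) x y L ∧
      y ∈ Set.extremePoints ℝ (standardPolyhedron A b) ∧
      (∀ c, x c = 0 → d c = 0 → y c = 0) ∧ 0 < y h ∧ ∃ c, d c < 0 ∧ y c = 0 := by
  by_cases hxh : x h = 0
  · have hfeas' : ∀ c, x c = 0 → 0 ≤ d c := fun c hc => by
      by_contra! hneg
      exact (hfeas c hneg).ne' hc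
    obtain ⟨e, he, t, ht, heh, hadj, -⟩ := exists_pivot hA hx
      (Z := Function.support x ∪ Function.support d) (fun c hc => by simp at hc; exact hc.1)
      ⟨hd, fun c hc => by simp at hc; exact hc.2⟩ hfeas' hh
    have hy := hadj.2.2.1
    have hsupp : ∀ c, x c = 0 → d c = 0 → (x + t • e) c = 0 := fun c h1 h2 => by
      simp [h1, he.2 c (by simp [h1, h2])]
    have hyh : 0 < (x + t • e) h := by simpa [hxh] using mul_pos ht heh
    rw [if_pos hxh]
    by_cases hdc : ∃ c, d c < 0 ∧ (x + t • e) c = 0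
    · exact ⟨_, 1, by omega, hadj.hasPathOfLength, hy, hsupp, hyh, hdc⟩
    push Not at hdc
    obtain ⟨z, L, hL, hpath, hz, hzsupp, hz'⟩ := exists_path_of_pos hA hy hd
      (fun c hc => lt_of_le_of_ne (hy.1.1 c) (hdc c hc).symm) hh hyh T hT hT2
    exact ⟨z, 1 + L, by omega, hadj.hasPathOfLength.trans hpath, hz,
      fun c h1 h2 => hzsupp c (hsupp c h1 h2) h2, hz'⟩
  · simpa [hxh] using exists_path_of_pos hA hx hd hfeas hh
      (lt_of_le_of_ne (hx.1.1 h) (Ne.symm hxh)) T hT hT2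

end Polytope
section Marginals

variable {X : Fin 3 → Type} [∀ t, Fintype (X t)] [∀ t, DecidableEq (X t)]

/-- The 1-marginals of a 3-way array. -/
def marginal : ((∀ t, X t) → ℝ) →ₗ[ℝ] (∀ t, X t → ℝ) where
  toFun x t a := ∑ c with c t = a, x c
  map_add' x y := by
    ext t a
    simp [Finset.sum_add_distrib]
  map_smul' r x := by
    ext t a
    simp [Finset.mul_sum]

lemma marginal_apply (x : (∀ t, X t) → ℝ) (t : Fin 3) (a : X t) :
    marginal x t a = ∑ c with c t = a, x c := rfl

lemma le_marginal {x : (∀ t, X t) → ℝ} (hx : ∀ c, 0 ≤ x c) (c : ∀ t, X t) (t : Fin 3) :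
    x c ≤ marginal x t (c t) :=
  Finset.single_le_sum (fun c _ => hx c) (by simp)

lemma marginal_single (c : ∀ t, X t) (r : ℝ) (t : Fin 3) (a : X t) :
    marginal (Pi.single c r) t a = if c t = a then r else 0 := by
  simp [marginal_apply, Pi.single_apply, Finset.sum_ite_eq']

lemma kerPointed_marginal : KerPointed (marginal (X := X)) := by
  intro d hd hpos
  ext c
  have := le_marginal hpos c 0
  rw [hd] at this
  exact le_antisymm this (hpos c)

lemma marginal_sum_single_eq {ι : Type} [Fintype ι] {e e' : ι → ∀ t, X t}
    (σ : Fin 3 → Equiv.Perm ι) (hσ : ∀ t r, e' r t = e (σ t r) t) :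
    marginal (∑ r, Pi.single (e' r) (1 : ℝ)) = marginal (∑ r, Pi.single (e r) (1 : ℝ)) := by
  ext t a
  simp only [map_sum, Finset.sum_apply, marginal_single, hσ]
  exact Equiv.sum_comp (σ t) fun r => if e r t = a then (1 : ℝ) else 0

variable {u : ∀ t, X t → ℝ}

/-- Exchanging the cells `e r` of the support of a vertex for the cells `e' r`, one of which is
`h`, strictly decreases the number of cells of the support that satisfy `Q`. -/
lemma exists_path_of_exchange {x : (∀ t, X t) → ℝ}
    (hx : x ∈ Set.extremePoints ℝ (standardPolyhedron marginal u)) {h : ∀ t, X t}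
    (Q : (∀ t, X t) → Prop) [DecidablePred Q] {ι : Type} [Fintype ι] [Nonempty ι]
    {e e' : ι → ∀ t, X t}
    (σ : Fin 3 → Equiv.Perm ι) (hσ : ∀ t r, e' r t = e (σ t r) t)
    (he : ∀ r, x (e r) ≠ 0) (heQ : ∀ r, Q (e r)) (heQ' : ∀ r, ¬ Q (e' r)) (hh : ∃ r, e' r = h)
    (T : Finset (∀ t, X t)) (hT : ∀ r, e' r = h ∨ e' r ∈ T) (hT2 : T.card ≤ 2) :
    ∃ y, ∃ L ≤ T.card + (if x h = 0 then 1 else 0),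
      HasPathOfLength (standardPolyhedron marginal u) x y L ∧
      y ∈ Set.extremePoints ℝ (standardPolyhedron marginal u) ∧ 0 < y h ∧
      (∀ c, y c ≠ 0 → x c ≠ 0 ∨ c = h ∨ c ∈ T) ∧
      (Finset.univ.filter fun c => y c ≠ 0 ∧ Q c).card <
        (Finset.univ.filter fun c => x c ≠ 0 ∧ Q c).card := by
  have hnn : ∀ (f : ι → ∀ t, X t) c, 0 ≤ (∑ r, Pi.single (M := fun _ => ℝ) (f r) (1 : ℝ)) c := by
    intro f c
    rw [Finset.sum_apply]
    refine Finset.sum_nonneg fun r _ => ?_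
    rw [Pi.single_apply]
    split_ifs <;> norm_num
  have hpos : ∀ (f : ι → ∀ t, X t) c,
      0 < (∑ r, Pi.single (M := fun _ => ℝ) (f r) (1 : ℝ)) c ↔ ∃ r, f r = c := by
    intro f c
    constructor
    · intro hlt
      by_contra! hne
      simp [Finset.sum_apply, fun r => (hne r).symm] at hlt
    · rintro ⟨r, rfl⟩
      rw [Finset.sum_apply]
      refine lt_of_lt_of_le zero_lt_one ((le_of_eq ?_).trans
        (Finset.single_le_sum (a := r) (fun s _ => ?_) (Finset.mem_univ r)))
      · simp
      · rw [Pi.single_apply]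
        split_ifs <;> norm_num
  set d : (∀ t, X t) → ℝ := ∑ r, Pi.single (e' r) 1 - ∑ r, Pi.single (e r) 1 with hd
  have hdneg : ∀ c, d c < 0 → ∃ r, e r = c := fun c hc => by
    rw [← hpos]
    have := hnn e' c
    rw [hd, Pi.sub_apply] at hc
    linarith
  have hdpos : ∀ c, 0 < d c → ∃ r, e' r = c := fun c hc => by
    rw [← hpos]
    have := hnn e c
    rw [hd, Pi.sub_apply] at hc
    linarith
  have hhe : 0 < d h := by
    have h1 := (hpos e' h).2 hh
    have h2 : ¬ 0 < (∑ r, Pi.single (M := fun _ => ℝ) (e r) (1 : ℝ)) h := by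
      rw [hpos]
      rintro ⟨r, rfl⟩
      obtain ⟨s, hs⟩ := hh
      exact heQ' s (hs ▸ heQ r)
    rw [hd, Pi.sub_apply]
    linarith
  have hfeas : ∀ c, d c < 0 → 0 < x c := fun c hc => by
    obtain ⟨r, rfl⟩ := hdneg c hc
    exact lt_of_le_of_ne (hx.1.1 _) (he r).symm
  obtain ⟨y, L, hL, hpath, hy, hsupp, hyh, c₀, hdc₀, hyc₀⟩ :=
    exists_path_of_feasible_direction kerPointed_marginal hx (h := h) (d := d)
      (by rw [hd, map_sub, marginal_sum_single_eq σ hσ, sub_self]) hfeas hhe T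
      (fun c hc hch => by
        obtain ⟨r, rfl⟩ := hdpos c hc
        exact (hT r).resolve_left hch) hT2
  have hnew : ∀ c, y c ≠ 0 → x c ≠ 0 ∨ ∃ r, e' r = c := fun c hyc => by
    by_contra! hcon
    refine hyc (hsupp c hcon.1 ?_)
    rcases lt_trichotomy (d c) 0 with h1 | h1 | h1
    · exact absurd hcon.1 (hfeas c h1).ne'
    · exact h1
    · obtain ⟨r, hr⟩ := hdpos c h1
      exact absurd hr (hcon.2 r)
  refine ⟨y, L, hL, hpath, hy, hyh, fun c hyc => ?_, Finset.card_lt_card ?_⟩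
  · refine (hnew c hyc).imp_right ?_
    rintro ⟨r, rfl⟩
    exact hT r
  · rw [Finset.ssubset_iff_of_subset]
    · refine ⟨c₀, ?_, by simp [hyc₀]⟩
      obtain ⟨r, rfl⟩ := hdneg c₀ hdc₀
      simp [he r, heQ r]
    · intro c
      simp only [Finset.mem_filter, Finset.mem_univ, true_and]
      rintro ⟨hyc, hQ⟩
      refine ⟨(hnew c hyc).resolve_right ?_, hQ⟩
      rintro ⟨r, rfl⟩
      exact heQ' r hQ

lemma exists_path_of_pair_exchange {x : (∀ t, X t) → ℝ}
    (hx : x ∈ Set.extremePoints ℝ (standardPolyhedron marginal u)) {h e f : ∀ t, X t}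
    (Q : (∀ t, X t) → Prop) [DecidablePred Q] (he : x e ≠ 0) (hf : x f ≠ 0) (heQ : Q e)
    (hfQ : Q f) (hhQ : ¬ Q h) (hef : ∀ t, e t = h t ∨ f t = h t)
    (hgQ : ¬ Q fun t => if e t = h t then f t else e t) :
    ∃ y, ∃ L ≤ 1 + (if x h = 0 then 1 else 0),
      HasPathOfLength (standardPolyhedron marginal u) x y L ∧
      y ∈ Set.extremePoints ℝ (standardPolyhedron marginal u) ∧ 0 < y h ∧
      (∀ c, y c ≠ 0 → x c ≠ 0 ∨ c = h ∨ c = fun t => if e t = h t then f t else e t) ∧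
      (Finset.univ.filter fun c => y c ≠ 0 ∧ Q c).card <
        (Finset.univ.filter fun c => x c ≠ 0 ∧ Q c).card := by
  have := exists_path_of_exchange hx (h := h) Q (e := ![e, f])
    (e' := ![h, fun t => if e t = h t then f t else e t])
    (fun t => if e t = h t then Equiv.refl _ else Equiv.swap 0 1)
    (fun t r => by
      have := hef t
      fin_cases r <;> by_cases h1 : e t = h t <;> simp_all)
    (fun r => by fin_cases r <;> simpa) (fun r => by fin_cases r <;> simpa)
    (fun r => by fin_cases r <;> simpa) ⟨0, rfl⟩ {fun t => if e t = h t then f t else e t}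
    (fun r => by fin_cases r <;> simp) (by simp)
  simpa using this

/-- The only cell of the support of `x` on some slice through `h` is `h` itself. -/
def SliceCleared (h : ∀ t, X t) (x : (∀ t, X t) → ℝ) : Prop :=
  ∃ t, ∀ c, x c ≠ 0 → c t = h t → c = h

lemma exists_path_sliceCleared_of_common (h : ∀ t, X t) (t₀ : Fin 3) (n : ℕ) :
    ∀ x ∈ Set.extremePoints ℝ (standardPolyhedron marginal u),
      (∀ c, x c ≠ 0 → (∃ t, c t = h t) → c t₀ = h t₀) →
      (Finset.univ.filter fun c => x c ≠ 0 ∧ c ≠ h ∧ ∃ t, t ≠ t₀ ∧ c t = h t).card ≤ n →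
      ∃ y, ∃ L ≤ (n - 1) + (if x h = 0 then 1 else 0),
        HasPathOfLength (standardPolyhedron marginal u) x y L ∧
        y ∈ Set.extremePoints ℝ (standardPolyhedron marginal u) ∧ SliceCleared h y := by
  have hcover : ∀ t₀ t : Fin 3, t = t₀ ∨ t = t₀ + 1 ∨ t = t₀ + 2 := by decide
  have hne1 : ∀ t₀ : Fin 3, t₀ + 1 ≠ t₀ := by decide
  have hne2 : ∀ t₀ : Fin 3, t₀ + 2 ≠ t₀ := by decide
  induction n using Nat.strong_induction_on with
  | _ n ih =>
    intro x hx hcommon hn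
    by_cases hfin : SliceCleared h x
    · exact ⟨x, 0, Nat.zero_le _, HasPathOfLength.refl _ _, hx, hfin⟩
    simp only [SliceCleared, not_exists, not_forall] at hfin
    obtain ⟨e, he, heh, hne⟩ := hfin (t₀ + 1)
    obtain ⟨f, hf, hfh, hnf⟩ := hfin (t₀ + 2)
    have he0 := hcommon e he ⟨_, heh⟩
    have hf0 := hcommon f hf ⟨_, hfh⟩
    have he2 : e (t₀ + 2) ≠ h (t₀ + 2) := fun h2 => hne <| by
      ext t
      rcases hcover t₀ t with rfl | rfl | rfl <;> assumption
    have hf1 : f (t₀ + 1) ≠ h (t₀ + 1) := fun h1 => hnf <| by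
      ext t
      rcases hcover t₀ t with rfl | rfl | rfl <;> assumption
    have hcard : 2 ≤ n := by
      refine le_trans ?_ hn
      rw [← Nat.lt_iff_add_one_le, Finset.one_lt_card]
      exact ⟨e, by simpa using ⟨he, hne, _, hne1 t₀, heh⟩, f,
        by simpa using ⟨hf, hnf, _, hne2 t₀, hfh⟩, fun hef => hf1 (hef ▸ heh)⟩
    obtain ⟨y, L, hL, hpath, hy, hyh, hsupp, hlt⟩ := exists_path_of_pair_exchange hx (h := h)
      (fun c => c ≠ h ∧ ∃ t, t ≠ t₀ ∧ c t = h t) he hf ⟨hne, _, hne1 t₀, heh⟩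
      ⟨hnf, _, hne2 t₀, hfh⟩ (by simp)
      (fun t => by rcases hcover t₀ t with rfl | rfl | rfl <;> tauto)
      (by
        rintro ⟨-, t, ht, hg⟩
        rcases hcover t₀ t with rfl | rfl | rfl
        · exact ht rfl
        · exact hf1 (by simpa [heh] using hg)
        · simp [he2] at hg)
    obtain ⟨z, M, hM, hpath', hz⟩ := ih (n - 1) (by omega) y hy
      (fun c hc hct => by
        rcases hsupp c hc with h1 | rfl | rfl
        · exact hcommon c h1 hct
        · rfl
        · simp [he0, hf0]) (by omega)
    rw [if_neg hyh.ne'] at hM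
    exact ⟨z, L + M, by omega, hpath.trans hpath', hz⟩

omit [∀ t, Fintype (X t)] in
/-- If some cell of `S` avoids exactly one of the slices through `h`, and no two cells of `S` are
complementary, then each of these slices is the only one avoided by some cell of `S`. -/
lemma exists_cell_through_all_but {S : Set (∀ t, X t)} {h : ∀ t, X t}
    (hS : ∀ c ∈ S, c ≠ h ∧ ∃ t, c t = h t) (hE : ∀ t, ∃ c ∈ S, c t = h t)
    (hG : ∀ t, ∃ c ∈ S, c t ≠ h t)
    (hcompl : ∀ e ∈ S, ∀ f ∈ S, ¬ ∀ t, e t = h t ↔ f t ≠ h t)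
    (hdouble : ∃ e ∈ S, ∃ t₃, e t₃ ≠ h t₃ ∧ ∀ t ≠ t₃, e t = h t) (t : Fin 3) :
    ∃ g ∈ S, ∀ s, g s = h s ↔ s ≠ t := by
  have hthird : ∀ t s : Fin 3, t ≠ s → ∃ r, r ≠ t ∧ r ≠ s ∧ ∀ k, k = t ∨ k = r ∨ k = s := by
    decide
  obtain ⟨e, he, t₃, he₃, het⟩ := hdouble
  by_cases htt : t = t₃
  · subst htt
    exact ⟨e, he, fun s => ⟨fun hs hst => he₃ (hst ▸ hs), het s⟩⟩
  obtain ⟨t', ht't, ht', hcover⟩ := hthird t t₃ htt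
  have hforall : ∀ p : Fin 3 → Prop, (∀ s, p s) ↔ p t ∧ p t' ∧ p t₃ := fun p =>
    ⟨fun hp => ⟨hp t, hp t', hp t₃⟩, fun hp s => by
      rcases hcover s with rfl | rfl | rfl
      exacts [hp.1, hp.2.1, hp.2.2]⟩
  have hpat : ∀ c : ∀ t, X t, (∀ s, c s = h s ↔ s ≠ t) ↔
      c t ≠ h t ∧ c t' = h t' ∧ c t₃ = h t₃ := fun c => by
    rw [hforall]
    simp [ht't, Ne.symm htt]
  have hne : ∀ c ∈ S, ¬ (c t = h t ∧ c t' = h t' ∧ c t₃ = h t₃) := fun c hc hc' =>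
    (hS c hc).1 (funext ((hforall fun s => c s = h s).2 hc'))
  have het₁ := het t htt
  have het₂ := het t' ht'
  obtain ⟨f, hf, hf₃⟩ := hE t₃
  obtain ⟨g, hg, hgt⟩ := hG t
  have hgs : g t' = h t' ∨ g t₃ = h t₃ := by
    by_contra! hcon
    obtain ⟨s, hs⟩ := (hS g hg).2
    exact (hforall fun s => g s ≠ h s).2 ⟨hgt, hcon⟩ s hs
  have h1 := hcompl e he f hf
  have h2 := hcompl e he g hg
  have h3 := hcompl f hf g hg
  have h4 := hne f hf
  simp only [hforall, het₁, het₂, he₃, hf₃, hgt, true_iff, false_iff, not_not, ne_eq,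
    not_true_eq_false, not_false_eq_true, and_true, iff_true, true_and, not_and] at h1 h2 h3 h4
  by_cases hf' : f t' = h t'
  · exact ⟨f, hf, (hpat f).2 ⟨fun h0 => h4 h0 hf', hf', hf₃⟩⟩
  · have hft : f t = h t := by
      by_contra h0
      exact hf' (h1 h0)
    simp only [hft, hf', false_iff, not_not, forall_const] at h3
    refine ⟨g, hg, (hpat g).2 ⟨hgt, ?_⟩⟩
    rcases hgs with h5 | h5
    · exact ⟨h5, h3 h5⟩
    · exact ⟨by_contra fun h6 => h2 h6 h5, h5⟩

lemma exists_path_sliceCleared (h : ∀ t, X t) (n : ℕ) :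
    ∀ x ∈ Set.extremePoints ℝ (standardPolyhedron marginal u),
      (Finset.univ.filter fun c => x c ≠ 0 ∧ c ≠ h ∧ ∃ t, c t = h t).card ≤ n →
      ∃ y, ∃ L ≤ 2 * (n - 1) + (if x h = 0 then 1 else 0),
        HasPathOfLength (standardPolyhedron marginal u) x y L ∧
        y ∈ Set.extremePoints ℝ (standardPolyhedron marginal u) ∧ SliceCleared h y := by
  have hthird : ∀ t s : Fin 3, t ≠ s → ∃ r, r ≠ t ∧ r ≠ s ∧ ∀ k, k = t ∨ k = r ∨ k = s := by
    decide
  induction n using Nat.strong_induction_on with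
  | _ n ih =>
    intro x hx hn
    by_cases hfin : SliceCleared h x
    · exact ⟨x, 0, Nat.zero_le _, HasPathOfLength.refl _ _, hx, hfin⟩
    simp only [SliceCleared, not_exists, not_forall] at hfin
    choose E hE hEh hnE using hfin
    have hcard : 2 ≤ n := by
      refine le_trans ?_ hn
      by_contra! hlt
      have h1 := Finset.card_le_one.1 (Nat.le_of_lt_succ hlt)
      refine hnE 0 (funext fun t => ?_)
      rw [← hEh t, h1 (E 0) (by simpa using ⟨hE 0, hnE 0, 0, hEh 0⟩) (E t)
        (by simpa using ⟨hE t, hnE t, t, hEh t⟩)]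
    by_cases hcommon : ∃ t₀, ∀ c, x c ≠ 0 → (∃ t, c t = h t) → c t₀ = h t₀
    · obtain ⟨t₀, ht₀⟩ := hcommon
      obtain ⟨y, L, hL, hy⟩ := exists_path_sliceCleared_of_common h t₀ n x hx ht₀
        (le_trans (Finset.card_le_card fun c => by
          simp only [Finset.mem_filter, Finset.mem_univ, true_and]
          rintro ⟨h1, h2, t, -, h3⟩
          exact ⟨h1, h2, t, h3⟩) hn)
      exact ⟨y, L, by omega, hy⟩
    suffices hstep : ∃ y, ∃ L ≤ 2 + (if x h = 0 then 1 else 0),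
        HasPathOfLength (standardPolyhedron marginal u) x y L ∧
        y ∈ Set.extremePoints ℝ (standardPolyhedron marginal u) ∧ 0 < y h ∧
        (Finset.univ.filter fun c => y c ≠ 0 ∧ c ≠ h ∧ ∃ t, c t = h t).card <
          (Finset.univ.filter fun c => x c ≠ 0 ∧ c ≠ h ∧ ∃ t, c t = h t).card by
      obtain ⟨y, L, hL, hpath, hy, hyh, hlt⟩ := hstep
      obtain ⟨z, M, hM, hpath', hz⟩ := ih (n - 1) (by omega) y hy (by omega)
      rw [if_neg hyh.ne'] at hM
      exact ⟨z, L + M, by omega, hpath.trans hpath', hz⟩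
    by_cases hcompl : ∃ e f, (x e ≠ 0 ∧ e ≠ h ∧ ∃ t, e t = h t) ∧
        (x f ≠ 0 ∧ f ≠ h ∧ ∃ t, f t = h t) ∧ ∀ t, e t = h t ↔ f t ≠ h t
    · obtain ⟨e, f, he, hf, hef⟩ := hcompl
      obtain ⟨y, L, hL, hpath, hy, hyh, -, hlt⟩ := exists_path_of_pair_exchange hx (h := h)
        (fun c => c ≠ h ∧ ∃ t, c t = h t) he.1 hf.1 he.2 hf.2 (by simp)
        (fun t => by have := hef t; tauto)
        (by
          rintro ⟨-, t, hg⟩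
          have := hef t
          dsimp only at hg
          split_ifs at hg <;> tauto)
      exact ⟨y, L, by omega, hpath, hy, hyh, hlt⟩
    by_cases hdouble : ∃ e t₃, (x e ≠ 0 ∧ e t₃ ≠ h t₃) ∧ ∀ t ≠ t₃, e t = h t
    · have hall := exists_cell_through_all_but
        (S := {c | x c ≠ 0 ∧ c ≠ h ∧ ∃ t, c t = h t}) (fun c hc => hc.2)
        (fun t => ⟨E t, ⟨hE t, hnE t, t, hEh t⟩, hEh t⟩)
        (fun t => by
          obtain ⟨g, hg⟩ := not_forall.1 (not_exists.1 hcommon t)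
          push Not at hg
          exact ⟨g, ⟨hg.1, fun h0 => hg.2.2 (by rw [h0]), hg.2.1⟩, hg.2.2⟩)
        (fun e he f hf hef => hcompl ⟨e, f, he, hf, hef⟩)
        (by
          obtain ⟨e, t₃, ⟨he, he₃⟩, het⟩ := hdouble
          obtain ⟨t, ht⟩ := exists_ne t₃
          exact ⟨e, ⟨he, fun h0 => he₃ (by rw [h0]), t, het t ht⟩, t₃, he₃, het⟩)
      choose G hG hGh using hall
      obtain ⟨y, L, hL, hpath, hy, hyh, -, hlt⟩ := exists_path_of_exchange hx (h := h)
        (fun c => c ≠ h ∧ ∃ t, c t = h t) (e := G) (e' := fun r t => G (t + r) t)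
        (fun t => Equiv.addLeft t) (fun t r => rfl) (fun r => (hG r).1)
        (fun r => ⟨fun h0 => (hGh r r).1 (by rw [h0]) rfl, r + 1, by simp [hGh]⟩)
        (fun r => by
          rintro ⟨h1, t, h2⟩
          rw [hGh] at h2
          refine h1 (funext fun s => ?_)
          rw [hGh]
          simpa using h2)
        ⟨1, funext fun s => by simp [hGh]⟩ {fun t => G t t}
        (fun r => by
          by_cases hr : r = 0
          · simp [hr]
          · exact Or.inl (funext fun s => by simpa [hGh] using hr))
        (by simp)
      exact ⟨y, L, by simp at hL; omega, hpath, hy, hyh, hlt⟩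
    · have hEs : ∀ t s, E t s = h s → s = t := by
        intro t s hs
        by_contra hst
        obtain ⟨t₃, h3s, h3t, hcover⟩ := hthird s t hst
        refine hdouble ⟨E t, t₃, ⟨hE t, fun h3 => hnE t (funext fun r => ?_)⟩, fun r hr => ?_⟩
        · rcases hcover r with rfl | rfl | rfl
          exacts [hs, h3, hEh _]
        · rcases hcover r with rfl | rfl | rfl
          exacts [hs, absurd rfl hr, hEh _]
      have hEs' : ∀ t r : Fin 3, E (t + r) t = h t → r = 0 := fun t r hr => by
        simpa using hEs _ _ hr
      obtain ⟨y, L, hL, hpath, hy, hyh, -, hlt⟩ := exists_path_of_exchange hx (h := h)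
        (fun c => c ≠ h ∧ ∃ t, c t = h t) (e := E) (e' := fun r t => E (t + r) t)
        (fun t => Equiv.addLeft t) (fun t r => rfl) hE
        (fun r => ⟨hnE r, r, hEh r⟩)
        (fun r => by
          rintro ⟨h1, t, h2⟩
          obtain rfl := hEs' _ _ h2
          exact h1 (funext fun s => by simpa using hEh s))
        ⟨0, funext fun s => by simpa using hEh s⟩ {fun t => E (t + 1) t, fun t => E (t + 2) t}
        (fun r => by
          fin_cases r
          · exact Or.inl (funext fun s => by simpa using hEh s)
          · simp
          · simp)
        Finset.card_le_two
      exact ⟨y, L, hL.trans (Nat.add_le_add_right Finset.card_le_two _), hpath, hy, hyh, hlt⟩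

/-- A vertex has at most as many nonzero coordinates as there are nonzero marginals, less two. -/
lemma card_support_add_two_le {x : (∀ t, X t) → ℝ}
    (hx : x ∈ Set.extremePoints ℝ (standardPolyhedron marginal u)) {h : ∀ t, X t}
    (hu : ∀ t, u t (h t) ≠ 0) :
    (Finset.univ.filter fun c => x c ≠ 0).card + 2 ≤
      ∑ t, (Finset.univ.filter fun a => u t a ≠ 0).card := by
  classical
  set S := Finset.univ.filter fun c => x c ≠ 0 with hS
  let I : Finset (Σ t, X t) := Finset.univ.sigma fun t => Finset.univ.filter fun a => u t a ≠ 0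
  let J : Finset (Σ t, X t) := {⟨1, h 1⟩, ⟨2, h 2⟩}
  have hJI : J ⊆ I := by
    intro i hi
    simp only [J, Finset.mem_insert, Finset.mem_singleton] at hi
    rcases hi with rfl | rfl <;> simp [I, hu]
  have hJ : J.card = 2 := Finset.card_pair (by simp)
  have hI : I.card = ∑ t, (Finset.univ.filter fun a => u t a ≠ 0).card := Finset.card_sigma _ _
  let φ : (S → ℝ) →ₗ[ℝ] ((I \ J : Finset _) → ℝ) :=
    { toFun := fun d i => marginal (fun c => if hc : c ∈ S then d ⟨c, hc⟩ else 0) i.1.1 i.1.2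
      map_add' := fun d e => by
        have hext : (fun c => if hc : c ∈ S then (d + e) ⟨c, hc⟩ else 0) =
            (fun c => if hc : c ∈ S then d ⟨c, hc⟩ else 0) +
              fun c => if hc : c ∈ S then e ⟨c, hc⟩ else 0 := by
          ext c
          by_cases hc : c ∈ S <;> simp [hc]
        ext i
        exact congrFun (congrFun ((congrArg marginal hext).trans (map_add _ _ _)) i.1.1) i.1.2
      map_smul' := fun r d => by
        have hext : (fun c => if hc : c ∈ S then (r • d) ⟨c, hc⟩ else 0) =
            r • fun c => if hc : c ∈ S then d ⟨c, hc⟩ else 0 := by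
          ext c
          by_cases hc : c ∈ S <;> simp [hc]
        ext i
        exact congrFun (congrFun ((congrArg marginal hext).trans (map_smul _ _ _)) i.1.1) i.1.2 }
  have hinj : Function.Injective φ := by
    rw [injective_iff_map_eq_zero]
    intro d hd
    set e : (∀ t, X t) → ℝ := fun c => if hc : c ∈ S then d ⟨c, hc⟩ else 0 with he
    have hsupp : ∀ c, x c = 0 → e c = 0 := fun c hc => by simp [he, hS, hc]
    have hzero : ∀ t a, u t a = 0 → marginal e t a = 0 := by
      intro t a hta
      rw [marginal_apply]
      refine Finset.sum_eq_zero fun c hc => hsupp c ?_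
      obtain rfl : c t = a := by simpa using hc
      refine le_antisymm ?_ (hx.1.1 c)
      rw [← hta, ← hx.1.2]
      exact le_marginal hx.1.1 c t
    have hmem : ∀ t a, (⟨t, a⟩ : Σ t, X t) ∉ J → marginal e t a = 0 := by
      intro t a hta
      by_cases h0 : u t a = 0
      · exact hzero t a h0
      · exact congrFun hd ⟨⟨t, a⟩, by simp [I, h0, hta]⟩
    have htotal : ∀ t, ∑ a, marginal e t a = ∑ c, e c := fun t => by
      simp only [marginal_apply]
      exact Finset.sum_fiberwise _ _ _
    have hsum : ∑ c, e c = 0 := by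
      rw [← htotal 0]
      exact Finset.sum_eq_zero fun a _ => hmem 0 a (by simp [J])
    have hker : marginal e = 0 := by
      ext t a
      by_cases hta : (⟨t, a⟩ : Σ t, X t) ∈ J
      · have hah : a = h t := by
          simp only [J, Finset.mem_insert, Finset.mem_singleton] at hta
          rcases hta with hta | hta <;> cases hta <;> rfl
        subst hah
        rw [Pi.zero_apply, Pi.zero_apply, ← hsum, ← htotal t]
        refine (Finset.sum_eq_single _ (fun a _ ha => hmem t a fun hta' => ha ?_)
          (by simp)).symm
        simp only [J, Finset.mem_insert, Finset.mem_singleton] at hta'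
        rcases hta' with hta' | hta' <;> cases hta' <;> rfl
      · exact hmem t a hta
    have hmemker : e ∈ kerOn marginal (Function.support x) :=
      ⟨hker, fun c hc => hsupp c (by simpa using hc)⟩
    rw [kerOn_support_eq_bot kerPointed_marginal hx, Submodule.mem_bot] at hmemker
    ext ⟨c, hc⟩
    simpa [he, hc] using congrFun hmemker c
  have hle := LinearMap.finrank_le_finrank_of_injective hinj
  simp only [Module.finrank_fintype_fun_eq_card, Fintype.card_coe] at hle
  rw [Finset.card_sdiff_of_subset hJI, hI, hJ] at hle
  have : 2 ≤ I.card := hJ ▸ Finset.card_le_card hJI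
  omega

/-- The vertices at which the entry at `h` attains an upper bound `m` form a face, which is the
translate of a polyhedron of the same kind. -/
lemma isExtreme_image_add_single {h : ∀ t, X t} {m : ℝ} (hm : 0 ≤ m)
    (hle : ∀ x ∈ standardPolyhedron marginal u, x h ≤ m) :
    IsExtreme ℝ (standardPolyhedron marginal u)
      (AffineEquiv.constVAdd ℝ ((∀ t, X t) → ℝ) (Pi.single h m) ''
        standardPolyhedron marginal (u - marginal (Pi.single h m))) := by
  have himage : AffineEquiv.constVAdd ℝ ((∀ t, X t) → ℝ) (Pi.single h m) ''
        standardPolyhedron marginal (u - marginal (Pi.single h m)) =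
      {x ∈ standardPolyhedron marginal u | x h = m} := by
    ext x
    constructor
    · rintro ⟨y, ⟨hy, hyu⟩, rfl⟩
      have hmem : Pi.single h m + y ∈ standardPolyhedron marginal u := by
        refine ⟨fun c => add_nonneg ?_ (hy c), by simp [hyu]⟩
        rw [Pi.single_apply]
        split_ifs
        exacts [hm, le_rfl]
      refine ⟨hmem, le_antisymm (hle _ hmem) ?_⟩
      simpa using hy h
    · rintro ⟨⟨hx, hxu⟩, hxh⟩
      refine ⟨x - Pi.single h m, ⟨fun c => ?_, by simp [hxu]⟩, by simp⟩
      by_cases hc : c = h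
      · subst hc
        simp [hxh]
      · simpa [hc] using hx c
  rw [himage]
  refine ⟨fun x hx => hx.1, ?_⟩
  rintro x hx y hy z ⟨-, hz⟩ ⟨r, s, hr, hs, hrs, rfl⟩
  refine ⟨hx, le_antisymm (hle x hx) ?_⟩
  simp only [Pi.add_apply, Pi.smul_apply, smul_eq_mul] at hz
  nlinarith [hle x hx, hle y hy]

/-- If all marginals of one kind vanish, the polyhedron contains at most the origin. -/
lemma eq_zero_of_mem_of_marginal_eq_zero {x : (∀ t, X t) → ℝ}
    (hx : x ∈ standardPolyhedron marginal u) {t : Fin 3} (ht : ∀ a, u t a = 0) : x = 0 := by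
  ext c
  refine le_antisymm ?_ (hx.1 c)
  rw [Pi.zero_apply, ← ht (c t), ← hx.2]
  exact le_marginal hx.1 c t

lemma SliceCleared.exists_apply_eq {h : ∀ t, X t} {x : (∀ t, X t) → ℝ} (hx : SliceCleared h x) :
    ∃ t, x h = marginal x t (h t) := by
  obtain ⟨t, ht⟩ := hx
  refine ⟨t, ?_⟩
  rw [marginal_apply]
  refine (Finset.sum_eq_single h (fun c hc hch => ?_) (by simp)).symm
  by_contra hne
  exact hch (ht c hne (by simpa using hc))

/-- The diameter bound, in terms of the number of nonzero marginals. -/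
theorem exists_path_length_le (n : ℕ) : ∀ u : ∀ t, X t → ℝ,
    ∑ t, (Finset.univ.filter fun a => u t a ≠ 0).card ≤ n + 2 →
    ∀ a ∈ Set.extremePoints ℝ (standardPolyhedron marginal u),
      ∀ b ∈ Set.extremePoints ℝ (standardPolyhedron marginal u),
        ∃ L ≤ 2 * n ^ 2, HasPathOfLength (standardPolyhedron marginal u) a b L := by
  induction n with
  | zero =>
    intro u hu a ha b hb
    by_cases hzero : ∃ t, ∀ i, u t i = 0
    · obtain ⟨t, ht⟩ := hzero
      rw [eq_zero_of_mem_of_marginal_eq_zero ha.1 ht, eq_zero_of_mem_of_marginal_eq_zero hb.1 ht]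
      exact ⟨0, Nat.zero_le _, .refl _ _⟩
    · push Not at hzero
      choose h hh using hzero
      have hcard : ∀ t ∈ Finset.univ,
          1 ≤ (Finset.univ.filter fun a => u t a ≠ 0).card := fun t _ =>
        Finset.card_pos.2 ⟨h t, by simp [hh]⟩
      have := Finset.sum_le_sum hcard
      simp only [Finset.sum_const, Finset.card_univ, Fintype.card_fin, smul_eq_mul] at this
      omega
  | succ n ih =>
    intro u hu a ha b hb
    by_cases hzero : ∃ t, ∀ i, u t i = 0
    · obtain ⟨t, ht⟩ := hzero
      rw [eq_zero_of_mem_of_marginal_eq_zero ha.1 ht, eq_zero_of_mem_of_marginal_eq_zero hb.1 ht]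
      exact ⟨0, Nat.zero_le _, .refl _ _⟩
    push Not at hzero
    choose h hh using hzero
    obtain ⟨t₀, ht₀⟩ := Finite.exists_min fun t => u t (h t)
    set m := u t₀ (h t₀) with hm
    have hle : ∀ x ∈ standardPolyhedron marginal u, x h ≤ m := fun x hx => by
      rw [hm, ← hx.2]
      exact le_marginal hx.1 h t₀
    have hm0 : 0 ≤ m := (ha.1.1 h).trans (hle a ha.1)
    have hface := isExtreme_image_add_single hm0 hle
    have hreach : ∀ x ∈ Set.extremePoints ℝ (standardPolyhedron marginal u),
        ∃ y ∈ Set.extremePoints ℝ (standardPolyhedron marginal (u - marginal (Pi.single h m))),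
        ∃ L ≤ 2 * n + 1, HasPathOfLength (standardPolyhedron marginal u) x
          (AffineEquiv.constVAdd ℝ ((∀ t, X t) → ℝ) (Pi.single h m) y) L := by
      intro x hx
      obtain ⟨y, L, hL, hpath, hy, hclear⟩ := exists_path_sliceCleared h _ x hx le_rfl
      have hcard := card_support_add_two_le hx hh
      have hsub : (Finset.univ.filter fun c => x c ≠ 0 ∧ c ≠ h ∧ ∃ t, c t = h t).card ≤
          (Finset.univ.filter fun c => x c ≠ 0).card :=
        Finset.card_le_card fun c hc => by
          simp only [Finset.mem_filter, Finset.mem_univ, true_and] at hc ⊢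
          exact hc.1
      obtain ⟨t, ht⟩ := hclear.exists_apply_eq
      have hyh : y h = m := le_antisymm (hle y hy.1) (by rw [ht, hy.1.2]; exact ht₀ t)
      have hadd : AffineEquiv.constVAdd ℝ ((∀ t, X t) → ℝ) (Pi.single h m)
          (y - Pi.single h m) = y := by simp
      have hsubmem : y - Pi.single h m ∈
          standardPolyhedron marginal (u - marginal (Pi.single h m)) := by
        refine ⟨fun c => ?_, by rw [map_sub, hy.1.2]⟩
        by_cases hc : c = h
        · subst hc
          simp [hyh]
        · simpa [hc] using hy.1.1 c
      refine ⟨y - Pi.single h m, ?_, L, ?_, by rwa [hadd]⟩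
      · have hyface : y ∈ Set.extremePoints ℝ
            (AffineEquiv.constVAdd ℝ ((∀ t, X t) → ℝ) (Pi.single h m) ''
              standardPolyhedron marginal (u - marginal (Pi.single h m))) := by
          rw [hface.extremePoints_eq]
          exact ⟨⟨_, hsubmem, hadd⟩, hy⟩
        have hback := mem_extremePoints_image_affineEquiv hyface
          (AffineEquiv.constVAdd ℝ ((∀ t, X t) → ℝ) (Pi.single h m)).symm
        rw [← Set.image_comp, ← AffineEquiv.coe_trans, AffineEquiv.self_trans_symm,
          AffineEquiv.coe_refl, Set.image_id] at hback
        rwa [← hadd, AffineEquiv.symm_apply_apply] at hback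
      · split_ifs at hL <;> omega
    obtain ⟨a', ha', L₁, hL₁, hpath₁⟩ := hreach a ha
    obtain ⟨b', hb', L₂, hL₂, hpath₂⟩ := hreach b hb
    have hdrop : ∑ t, (Finset.univ.filter fun a =>
        (u - marginal (Pi.single h m)) t a ≠ 0).card <
          ∑ t, (Finset.univ.filter fun a => u t a ≠ 0).card := by
      have hsub : ∀ t, (Finset.univ.filter fun a => (u - marginal (Pi.single h m)) t a ≠ 0) ⊆
          Finset.univ.filter fun a => u t a ≠ 0 := by
        intro t a
        simp only [Finset.mem_filter, Finset.mem_univ, true_and, Pi.sub_apply, marginal_single]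
        contrapose!
        intro hta
        rw [if_neg, hta, sub_zero]
        rintro rfl
        exact hh t hta
      refine Finset.sum_lt_sum (fun t _ => Finset.card_le_card (hsub t))
        ⟨t₀, Finset.mem_univ _, Finset.card_lt_card ((Finset.ssubset_iff_of_subset (hsub t₀)).2
          ⟨h t₀, by simp [hh], ?_⟩)⟩
      simp [marginal_single, ← hm]
    obtain ⟨L, hL, hpath⟩ := ih _ (by omega) a' ha' b' hb'
    exact ⟨L₁ + L + L₂, by nlinarith, (hpath₁.trans (hpath.image _ hface)).trans hpath₂.symm⟩

end Marginals

section Triples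

variable {d : Fin 3 → ℕ}

/-- Cells of a three-way table as triples of indices. -/
def cellEquiv : (∀ t, Fin (d t)) ≃ Fin (d 0) × Fin (d 1) × Fin (d 2) where
  toFun c := (c 0, c 1, c 2)
  invFun e := fun
    | 0 => e.1
    | 1 => e.2.1
    | 2 => e.2.2
  left_inv c := by
    ext t
    fin_cases t <;> rfl
  right_inv _ := rfl

/-- Tables indexed by cells, as curried functions of three indices. -/
def tableEquiv : ((∀ t, Fin (d t)) → ℝ) ≃ₗ[ℝ] (Fin (d 0) → Fin (d 1) → Fin (d 2) → ℝ) where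
  toFun x i j k := x (cellEquiv.symm (i, j, k))
  invFun y c := y (c 0) (c 1) (c 2)
  map_add' _ _ := rfl
  map_smul' _ _ := rfl
  left_inv x := by
    ext c
    exact congrArg x (cellEquiv.symm_apply_apply c)
  right_inv _ := rfl

lemma sum_cell_eq (f : (∀ t, Fin (d t)) → ℝ) :
    ∑ c, f c = ∑ i, ∑ j, ∑ k, f (cellEquiv.symm (i, j, k)) := by
  rw [← cellEquiv.symm.sum_comp, Fintype.sum_prod_type]
  simp only [Fintype.sum_prod_type]

lemma axialPolytope_eq_image (u : ∀ t, Fin (d t) → ℝ) :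
    axialPolytope (u 0) (u 1) (u 2) =
      (tableEquiv (d := d)).toAffineEquiv '' standardPolyhedron marginal u := by
  have h0 : ∀ (x : (∀ t, Fin (d t)) → ℝ) i,
      marginal x 0 i = ∑ j, ∑ k, tableEquiv x i j k := fun x i => by
    rw [marginal_apply, Finset.sum_filter, sum_cell_eq, Finset.sum_eq_single i]
    · simp [cellEquiv, tableEquiv]
    · intro i' _ hi'
      simp [cellEquiv, hi']
    · simp
  have h1 : ∀ (x : (∀ t, Fin (d t)) → ℝ) j,
      marginal x 1 j = ∑ i, ∑ k, tableEquiv x i j k := fun x j => by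
    rw [marginal_apply, Finset.sum_filter, sum_cell_eq]
    refine Finset.sum_congr rfl fun i _ => ?_
    rw [Finset.sum_eq_single j]
    · simp [cellEquiv, tableEquiv]
    · intro j' _ hj'
      simp [cellEquiv, hj']
    · simp
  have h2 : ∀ (x : (∀ t, Fin (d t)) → ℝ) k,
      marginal x 2 k = ∑ i, ∑ j, tableEquiv x i j k := fun x k => by
    rw [marginal_apply, Finset.sum_filter, sum_cell_eq]
    refine Finset.sum_congr rfl fun i _ => Finset.sum_congr rfl fun j _ => ?_
    rw [Finset.sum_eq_single k]
    · simp [cellEquiv, tableEquiv]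
    · intro k' _ hk'
      simp [cellEquiv, hk']
    · simp
  ext y
  constructor
  · rintro ⟨hy, hy0, hy1, hy2⟩
    refine ⟨tableEquiv.symm y, ⟨fun c => hy _ _ _, ?_⟩, tableEquiv.apply_symm_apply y⟩
    ext t a
    fin_cases t
    · exact ((h0 _ a).trans (by rw [LinearEquiv.apply_symm_apply])).trans (hy0 a)
    · exact ((h1 _ a).trans (by rw [LinearEquiv.apply_symm_apply])).trans (hy1 a)
    · exact ((h2 _ a).trans (by rw [LinearEquiv.apply_symm_apply])).trans (hy2 a)
  · rintro ⟨x, ⟨hx, rfl⟩, rfl⟩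
    exact ⟨fun i j k => hx _, fun i => (h0 x i).symm, fun j => (h1 x j).symm,
      fun k => (h2 x k).symm⟩

lemma exists_path_axialPolytope_length_le (u : ∀ t, Fin (d t) → ℝ) {n : ℕ}
    (hn : d 0 + d 1 + d 2 ≤ n + 2) :
    ∀ a ∈ Set.extremePoints ℝ (axialPolytope (u 0) (u 1) (u 2)),
      ∀ b ∈ Set.extremePoints ℝ (axialPolytope (u 0) (u 1) (u 2)),
        ∃ L ≤ 2 * n ^ 2, HasPathOfLength (axialPolytope (u 0) (u 1) (u 2)) a b L := by
  have himage := axialPolytope_eq_image u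
  set f := (tableEquiv (d := d)).toAffineEquiv
  have hpull : ∀ a ∈ Set.extremePoints ℝ (axialPolytope (u 0) (u 1) (u 2)),
      f.symm a ∈ Set.extremePoints ℝ (standardPolyhedron marginal u) := fun a ha => by
    have hback := mem_extremePoints_image_affineEquiv ha f.symm
    rwa [himage, ← Set.image_comp, ← AffineEquiv.coe_trans, AffineEquiv.self_trans_symm,
      AffineEquiv.coe_refl, Set.image_id] at hback
  have hcard : ∑ t, (Finset.univ.filter fun a => u t a ≠ 0).card ≤ n + 2 := by
    refine (Finset.sum_le_sum fun t _ => Finset.card_le_univ _).trans ?_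
    simpa [Fin.sum_univ_three] using hn
  intro a ha b hb
  obtain ⟨L, hL, hpath⟩ := exists_path_length_le n u hcard _ (hpull a ha) _ (hpull b hb)
  have hface : IsExtreme ℝ (axialPolytope (u 0) (u 1) (u 2))
      (f '' standardPolyhedron marginal u) := himage ▸ IsExtreme.refl ℝ _
  have hpush := hpath.image f hface
  rw [AffineEquiv.apply_symm_apply, AffineEquiv.apply_symm_apply] at hpush
  exact ⟨L, hL, hpush⟩

end Triples

/-- The graph of a 3-way axial `p × q × s` transportation polytope has diameter at most
`2(p+q+s-2)²`. -/
theorem axialPolytope_diameter_le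
    (p q s : ℕ) (hp : 1 ≤ p) (hq : 1 ≤ q) (hs : 1 ≤ s)
    (u : Fin p → ℝ) (v : Fin q → ℝ) (w : Fin s → ℝ)
    (hu : ∀ i, 0 ≤ u i) (hv : ∀ j, 0 ≤ v j) (hw : ∀ k, 0 ≤ w k) :
    ∀ a ∈ Set.extremePoints ℝ (axialPolytope u v w),
      ∀ b ∈ Set.extremePoints ℝ (axialPolytope u v w),
        ∃ L ≤ 2 * (p + q + s - 2) ^ 2,
          HasPathOfLength (axialPolytope u v w) a b L := by
  intro a ha b hb
  exact exists_path_axialPolytope_length_le (d := ![p, q, s])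
    (fun | 0 => u | 1 => v | 2 => w) (n := p + q + s - 2)
    (show p + q + s ≤ p + q + s - 2 + 2 by omega) a ha b hb
end
end

section
/- Let p, q ≥ 1, let u : Fin p → ℝ and v : Fin q → ℝ have all entries strictly positive, and suppose ∑_i u i = ∑_j v j. Then the affine span of the classical transportation polytope T(u,v) has dimension (p−1)·(q−1); that is, Module.finrank ℝ of the direction of affineSpan ℝ (T(u,v)) equals (p−1)·(q−1) (= pq − p − q + 1). -/
open scoped BigOperators

noncomputable section

theorem finrank_ker_sum_proj {ι W : Type*} [Fintype ι] [Nonempty ι] [AddCommGroup W] [Module ℝ W]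
    [FiniteDimensional ℝ W] :
    Module.finrank ℝ (LinearMap.ker (∑ i, LinearMap.proj i : (ι → W) →ₗ[ℝ] W))
      = (Fintype.card ι - 1) * Module.finrank ℝ W := by
  classical
  have hsurj : Function.Surjective (∑ i, LinearMap.proj i : (ι → W) →ₗ[ℝ] W) := fun w =>
    ⟨Pi.single (Classical.arbitrary ι) w, by simp [LinearMap.sum_apply]⟩
  have h := LinearMap.finrank_range_add_finrank_ker (∑ i, LinearMap.proj i : (ι → W) →ₗ[ℝ] W)
  rw [LinearMap.range_eq_top.2 hsurj, finrank_top, Module.finrank_pi_fintype, Finset.sum_const,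
    Finset.card_univ, smul_eq_mul] at h
  rw [Nat.sub_mul, one_mul]
  omega

/-- The matrices all of whose row sums and column sums vanish. -/
def zeroMarginals (ι κ : Type*) [Fintype ι] [Fintype κ] : Submodule ℝ (ι → κ → ℝ) where
  carrier := {d | (∀ i, ∑ j, d i j = 0) ∧ ∀ j, ∑ i, d i j = 0}
  zero_mem' := by simp
  add_mem' := by
    rintro a b ⟨ha, ha'⟩ ⟨hb, hb'⟩
    simp [Finset.sum_add_distrib, ha, ha', hb, hb']
  smul_mem' := by
    rintro c a ⟨ha, ha'⟩
    simp [← Finset.mul_sum, ha, ha']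

theorem mem_zeroMarginals {ι κ : Type*} [Fintype ι] [Fintype κ] {d : ι → κ → ℝ} :
    d ∈ zeroMarginals ι κ ↔ (∀ i, ∑ j, d i j = 0) ∧ ∀ j, ∑ i, d i j = 0 :=
  Iff.rfl

theorem zeroMarginals_eq_map (ι κ : Type*) [Fintype ι] [Fintype κ] :
    zeroMarginals ι κ =
      (LinearMap.ker (∑ i, LinearMap.proj i :
        (ι → LinearMap.ker (∑ j, LinearMap.proj j : (κ → ℝ) →ₗ[ℝ] ℝ)) →ₗ[ℝ] _)).map
        ((Submodule.subtype _).compLeft ι) := by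
  ext d
  rw [mem_zeroMarginals, Submodule.mem_map]
  constructor
  · rintro ⟨hr, hc⟩
    refine ⟨fun i => ⟨d i, by simpa [LinearMap.sum_apply] using hr i⟩, ?_, rfl⟩
    ext j
    simpa [LinearMap.sum_apply] using hc j
  · rintro ⟨x, hx, rfl⟩
    refine ⟨fun i => (LinearMap.sum_apply _ _ _).symm.trans (x i).2, fun j => ?_⟩
    have h := congrFun (congrArg Subtype.val (LinearMap.mem_ker.1 hx)) j
    simpa [LinearMap.sum_apply] using h

theorem finrank_zeroMarginals (ι κ : Type*) [Fintype ι] [Fintype κ] [Nonempty ι] [Nonempty κ] :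
    Module.finrank ℝ (zeroMarginals ι κ) = (Fintype.card ι - 1) * (Fintype.card κ - 1) := by
  have hinj : Function.Injective
      ((LinearMap.ker (∑ j, LinearMap.proj j : (κ → ℝ) →ₗ[ℝ] ℝ)).subtype.compLeft ι) :=
    fun x y h => funext fun i => Subtype.ext (congrFun h i)
  rw [zeroMarginals_eq_map, ← (Submodule.equivMapOfInjective _ hinj _).finrank_eq,
    finrank_ker_sum_proj, finrank_ker_sum_proj, Module.finrank_self, mul_one]

theorem vectorSpan_transportationPolytope_le {p q : ℕ} (u : Fin p → ℝ) (v : Fin q → ℝ) :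
    vectorSpan ℝ (transportationPolytope u v) ≤ zeroMarginals (Fin p) (Fin q) := by
  rw [vectorSpan_def, Submodule.span_le]
  rintro _ ⟨x, ⟨-, hxu, hxv⟩, y, ⟨-, hyu, hyv⟩, rfl⟩
  refine mem_zeroMarginals.2 ⟨fun i => ?_, fun j => ?_⟩
  · simp [Finset.sum_sub_distrib, hxu, hyu]
  · simp [Finset.sum_sub_distrib, hxv, hyv]

open Filter Topology in
theorem zeroMarginals_le_vectorSpan_of_pos {p q : ℕ} {u : Fin p → ℝ} {v : Fin q → ℝ}
    {x : Fin p → Fin q → ℝ} (hx : x ∈ transportationPolytope u v) (hpos : ∀ i j, 0 < x i j) :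
    zeroMarginals (Fin p) (Fin q) ≤ vectorSpan ℝ (transportationPolytope u v) := by
  rintro d ⟨hdu, hdv⟩
  have hev : ∀ᶠ ε : ℝ in 𝓝[>] 0, ∀ i j, 0 < x i j + ε * d i j := by
    refine eventually_all.2 fun i => eventually_all.2 fun j => nhdsWithin_le_nhds ?_
    have hc : ContinuousAt (fun ε : ℝ => x i j + ε * d i j) 0 := by fun_prop
    exact hc.eventually_const_lt (by simpa using hpos i j)
  obtain ⟨ε, hε, hε0⟩ := (hev.and self_mem_nhdsWithin).exists
  have hy : x + ε • d ∈ transportationPolytope u v := by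
    refine ⟨fun i j => (hε i j).le, fun i => ?_, fun j => ?_⟩
    · simp [Finset.sum_add_distrib, ← Finset.mul_sum, hdu, hx.2.1]
    · simp [Finset.sum_add_distrib, ← Finset.mul_sum, hdv, hx.2.2]
  have h := vsub_mem_vectorSpan ℝ hy hx
  rw [vsub_eq_sub, add_sub_cancel_left] at h
  exact (Submodule.smul_mem_iff _ (ne_of_gt hε0)).1 h

theorem mul_div_sum_mem_transportationPolytope {p q : ℕ} {u : Fin p → ℝ} {v : Fin q → ℝ}
    (hu : ∀ i, 0 ≤ u i) (hv : ∀ j, 0 ≤ v j) (hsum : ∑ i, u i = ∑ j, v j)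
    (hne : ∑ j, v j ≠ 0) :
    (fun i j => u i * v j / ∑ k, v k) ∈ transportationPolytope u v := by
  refine ⟨fun i j => div_nonneg (mul_nonneg (hu i) (hv j)) (Finset.sum_nonneg fun k _ => hv k),
    fun i => ?_, fun j => ?_⟩
  · rw [← Finset.sum_div, ← Finset.mul_sum, mul_div_cancel_right₀ _ hne]
  · rw [← Finset.sum_div, ← Finset.sum_mul, hsum, mul_div_cancel_left₀ _ hne]

/-- A nonempty classical `p × q` transportation polytope with strictly positive marginals has
dimension `(p-1)(q-1)`. -/
theorem finrank_direction_affineSpan_transportationPolytope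
    (p q : ℕ) (hp : 1 ≤ p) (hq : 1 ≤ q)
    (u : Fin p → ℝ) (v : Fin q → ℝ)
    (hu : ∀ i, 0 < u i) (hv : ∀ j, 0 < v j)
    (hsum : ∑ i, u i = ∑ j, v j) :
    Module.finrank ℝ (affineSpan ℝ (transportationPolytope u v)).direction
      = (p - 1) * (q - 1) := by
  have : Nonempty (Fin p) := ⟨⟨0, hp⟩⟩
  have : Nonempty (Fin q) := ⟨⟨0, hq⟩⟩
  have hS : 0 < ∑ j, v j := Finset.sum_pos (fun j _ => hv j) Finset.univ_nonempty
  have hx := mul_div_sum_mem_transportationPolytope (fun i => (hu i).le) (fun j => (hv j).le)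
    hsum hS.ne'
  rw [direction_affineSpan, (vectorSpan_transportationPolytope_le u v).antisymm
    (zeroMarginals_le_vectorSpan_of_pos hx fun i j => div_pos (mul_pos (hu i) (hv j)) hS),
    finrank_zeroMarginals, Fintype.card_fin, Fintype.card_fin]
end
end

section
/- Let p, q ≥ 1, let u : Fin p → ℝ and v : Fin q → ℝ have all entries strictly positive, and assume the classical transportation polytope T(u,v) is generic. Then a point x ∈ T(u,v) is an extreme point of T(u,v) if and only if the support of x has exactly p + q − 1 elements, i.e. Set.ncard { (i,j) : Fin p × Fin q | x i j > 0 } = p + q − 1. -/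
open scoped BigOperators

noncomputable section

open scoped Matrix

/-- The incidence matrix of the bipartite graph on `m ⊕ n` with edge set `S`. -/
def bipartiteIncidence {m n : Type*} [DecidableEq m] [DecidableEq n] (S : Finset (m × n)) :
    Matrix (m ⊕ n) S ℝ :=
  fun k s => Sum.elim (fun i => if s.1.1 = i then 1 else 0) (fun j => if s.1.2 = j then 1 else 0) k

section Incidence

variable {m n : Type*} [Fintype m] [Fintype n] [DecidableEq m] [DecidableEq n]

lemma bipartiteIncidence_transpose_mulVec (S : Finset (m × n)) (w : m ⊕ n → ℝ) (s : S) :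
    ((bipartiteIncidence S)ᵀ *ᵥ w) s = w (Sum.inl s.1.1) + w (Sum.inr s.1.2) := by
  simp [Matrix.mulVec, dotProduct, bipartiteIncidence]

lemma sum_coe_sort_eq_of_support {α : Type*} [Fintype α] {S : Finset α} {f : α → ℝ}
    (hf : ∀ a ∉ S, f a = 0) : ∑ s : S, f s = ∑ a, f a := by
  rw [Finset.sum_coe_sort S f]
  exact Finset.sum_subset (Finset.subset_univ S) fun a _ ha => hf a ha

lemma bipartiteIncidence_mulVec_inl {S : Finset (m × n)} {f : m → n → ℝ}
    (hf : ∀ i j, (i, j) ∉ S → f i j = 0) (i : m) :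
    (bipartiteIncidence S *ᵥ fun s => f s.1.1 s.1.2) (Sum.inl i) = ∑ j, f i j := by
  have h := sum_coe_sort_eq_of_support (S := S)
    (f := fun a : m × n => (if a.1 = i then 1 else 0) * f a.1 a.2)
    (fun a ha => by simp [hf a.1 a.2 ha])
  simp only [Matrix.mulVec, dotProduct, bipartiteIncidence, Sum.elim_inl]
  rw [h, Fintype.sum_prod_type_right]
  simp

lemma bipartiteIncidence_mulVec_inr {S : Finset (m × n)} {f : m → n → ℝ}
    (hf : ∀ i j, (i, j) ∉ S → f i j = 0) (j : n) :
    (bipartiteIncidence S *ᵥ fun s => f s.1.1 s.1.2) (Sum.inr j) = ∑ i, f i j := by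
  have h := sum_coe_sort_eq_of_support (S := S)
    (f := fun a : m × n => (if a.2 = j then 1 else 0) * f a.1 a.2)
    (fun a ha => by simp [hf a.1 a.2 ha])
  simp only [Matrix.mulVec, dotProduct, bipartiteIncidence, Sum.elim_inr]
  rw [h, Fintype.sum_prod_type]
  simp

/-- If the only potentials balanced along `S` are the constant ones, the incidence matrix has
corank one. -/
lemma rank_bipartiteIncidence_add_one [Nonempty m] {S : Finset (m × n)}
    (hS : ∀ (a : m → ℝ) (b : n → ℝ), (∀ s ∈ S, a s.1 + b s.2 = 0) →
      ∃ c, (∀ i, a i = c) ∧ ∀ j, b j = -c) :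
    (bipartiteIncidence S).rank + 1 = Fintype.card m + Fintype.card n := by
  have hker : LinearMap.ker (bipartiteIncidence S)ᵀ.mulVecLin =
      Submodule.span ℝ {Sum.elim (fun _ : m => (1 : ℝ)) (fun _ : n => -1)} := by
    ext w
    rw [LinearMap.mem_ker, Matrix.mulVecLin_apply, Submodule.mem_span_singleton]
    constructor
    · intro hw
      obtain ⟨c, ha, hb⟩ := hS (fun i => w (Sum.inl i)) (fun j => w (Sum.inr j)) fun s hs => by
        have := congrFun hw ⟨s, hs⟩
        rwa [bipartiteIncidence_transpose_mulVec] at this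
      refine ⟨c, ?_⟩
      ext (i | j)
      · simp [ha]
      · simp [hb]
    · rintro ⟨c, rfl⟩
      ext s
      simp [bipartiteIncidence_transpose_mulVec]
  have hne : Sum.elim (fun _ : m => (1 : ℝ)) (fun _ : n => -1) ≠ 0 := fun h => by
    simpa using congrFun h (Sum.inl (Classical.arbitrary m))
  have h := LinearMap.finrank_range_add_finrank_ker (bipartiteIncidence S)ᵀ.mulVecLin
  rw [hker, finrank_span_singleton hne, Module.finrank_fintype_fun_eq_card,
    Fintype.card_sum] at h
  rw [← Matrix.rank_transpose]
  exact h

/-- The columns of a matrix are independent exactly when its rank is the number of columns. -/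
lemma Matrix.rank_eq_card_iff_mulVec_eq_zero {k l : Type*} [Fintype k] [Fintype l]
    (A : Matrix k l ℝ) :
    A.rank = Fintype.card l ↔ ∀ d, A *ᵥ d = 0 → d = 0 := by
  have h := LinearMap.finrank_range_add_finrank_ker A.mulVecLin
  rw [Module.finrank_fintype_fun_eq_card] at h
  rw [← Matrix.ker_mulVecLin_eq_bot_iff, ← Submodule.finrank_eq_zero (R := ℝ), Matrix.rank]
  lia

end Incidence

section Transportation

variable {p q : ℕ} {u : Fin p → ℝ} {v : Fin q → ℝ} {x : Fin p → Fin q → ℝ}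

lemma exists_pos_of_row_sum_pos (hu : ∀ i, 0 < u i) (hx : x ∈ transportationPolytope u v)
    (i : Fin p) : ∃ j, 0 < x i j := by
  have h : 0 < ∑ j, x i j := by rw [hx.2.1]; exact hu i
  obtain ⟨j, -, hj⟩ := Finset.exists_lt_of_sum_lt (s := Finset.univ) (f := fun _ => (0 : ℝ))
    (by simpa using h)
  exact ⟨j, hj⟩

lemma exists_pos_of_col_sum_pos (hv : ∀ j, 0 < v j) (hx : x ∈ transportationPolytope u v)
    (j : Fin q) : ∃ i, 0 < x i j := by
  have h : 0 < ∑ i, x i j := by rw [hx.2.2]; exact hv j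
  obtain ⟨i, -, hi⟩ := Finset.exists_lt_of_sum_lt (s := Finset.univ) (f := fun _ => (0 : ℝ))
    (by simpa using h)
  exact ⟨i, hi⟩

/-- A union of connected components of the support has equal row and column marginals. -/
lemma sum_eq_sum_of_closed (hx : x ∈ transportationPolytope u v)
    {Y : Finset (Fin p)} {Z : Finset (Fin q)} (hYZ : ∀ i j, 0 < x i j → (i ∈ Y ↔ j ∈ Z)) :
    ∑ i ∈ Y, u i = ∑ j ∈ Z, v j := by
  have hzero : ∀ i j, ¬(i ∈ Y ↔ j ∈ Z) → x i j = 0 := fun i j h =>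
    ((hx.1 i j).eq_or_lt.resolve_right fun hpos => h (hYZ i j hpos)).symm
  calc ∑ i ∈ Y, u i = ∑ i ∈ Y, ∑ j ∈ Z, x i j := by
        refine Finset.sum_congr rfl fun i hi => ?_
        rw [← hx.2.1 i]
        exact (Finset.sum_subset (Finset.subset_univ Z) fun j _ hj =>
          hzero i j (by simp [hi, hj])).symm
    _ = ∑ j ∈ Z, ∑ i ∈ Y, x i j := Finset.sum_comm
    _ = ∑ j ∈ Z, v j := by
        refine Finset.sum_congr rfl fun j hj => ?_
        rw [← hx.2.2 j]
        exact Finset.sum_subset (Finset.subset_univ Y) fun i _ hi =>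
          hzero i j (by simp [hi, hj])

/-- In a generic transportation polytope the support graph of every point is connected. -/
lemma potential_const_of_isGeneric (hp : 1 ≤ p) (hu : ∀ i, 0 < u i) (hv : ∀ j, 0 < v j)
    (hgen : IsGeneric u v) (hx : x ∈ transportationPolytope u v)
    {a : Fin p → ℝ} {b : Fin q → ℝ} (hab : ∀ i j, 0 < x i j → a i + b j = 0) :
    ∃ c, (∀ i, a i = c) ∧ ∀ j, b j = -c := by
  let i₀ : Fin p := ⟨0, hp⟩
  let Y : Finset (Fin p) := {i | a i = a i₀}
  let Z : Finset (Fin q) := {j | b j = -a i₀}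
  have hYZ : ∀ i j, 0 < x i j → (i ∈ Y ↔ j ∈ Z) := fun i j h => by
    have := hab i j h
    simp only [Y, Z, Finset.mem_filter_univ]
    constructor <;> intro <;> linarith
  have hi₀ : i₀ ∈ Y := by simp [Y]
  obtain ⟨j₀, hj₀⟩ := exists_pos_of_row_sum_pos hu hx i₀
  have hj₀Z : j₀ ∈ Z := (hYZ i₀ j₀ hj₀).1 hi₀
  have hall : (∀ i, i ∈ Y) ∧ ∀ j, j ∈ Z := by
    by_cases hY : Y = Finset.univ
    · refine ⟨fun i => hY ▸ Finset.mem_univ i, fun j => ?_⟩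
      obtain ⟨i, hi⟩ := exists_pos_of_col_sum_pos hv hx j
      exact (hYZ i j hi).1 (hY ▸ Finset.mem_univ i)
    · by_cases hZ : Z = Finset.univ
      · refine ⟨fun i => ?_, fun j => hZ ▸ Finset.mem_univ j⟩
        obtain ⟨j, hj⟩ := exists_pos_of_row_sum_pos hu hx i
        exact (hYZ i j hj).2 (hZ ▸ Finset.mem_univ j)
      · exact absurd (sum_eq_sum_of_closed hx hYZ) (hgen Y Z ⟨i₀, hi₀⟩ hY ⟨j₀, hj₀Z⟩ hZ)
  exact ⟨a i₀, fun i => by simpa [Y] using hall.1 i, fun j => by simpa [Z] using hall.2 j⟩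

/-- A point is extreme if and only if no nonzero matrix with zero marginals is supported in its
support. -/
lemma mem_extremePoints_transportationPolytope_iff (hx : x ∈ transportationPolytope u v) :
    x ∈ Set.extremePoints ℝ (transportationPolytope u v) ↔
      ∀ d : Fin p → Fin q → ℝ, (∀ i j, ¬0 < x i j → d i j = 0) → (∀ i, ∑ j, d i j = 0) →
        (∀ j, ∑ i, d i j = 0) → d = 0 := by
  constructor
  · intro hext d hd hrow hcol
    obtain ⟨ε, hε, hle⟩ : ∃ ε > 0, ∀ ij : Fin p × Fin q, ε * |d ij.1 ij.2| ≤ x ij.1 ij.2 := by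
      have hev : ∀ ij : Fin p × Fin q,
          ∀ᶠ ε in nhdsWithin (0 : ℝ) (Set.Ioi 0), ε * |d ij.1 ij.2| ≤ x ij.1 ij.2 := by
        intro ij
        by_cases h : 0 < x ij.1 ij.2
        · have ht : Filter.Tendsto (fun ε : ℝ => ε * |d ij.1 ij.2|)
              (nhdsWithin 0 (Set.Ioi 0)) (nhds 0) := by
            have : Continuous fun ε : ℝ => ε * |d ij.1 ij.2| := by fun_prop
            simpa using (this.tendsto 0).mono_left nhdsWithin_le_nhds
          exact (ht.eventually_lt_const h).mono fun _ => le_of_lt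
        · exact Filter.Eventually.of_forall fun ε => by
            simpa [hd _ _ h] using hx.1 ij.1 ij.2
      obtain ⟨ε, h₁, h₂⟩ := ((Filter.eventually_all.2 hev).and self_mem_nhdsWithin).exists
      exact ⟨ε, h₂, h₁⟩
    have hmem : ∀ c : ℝ, |c| = ε → x + c • d ∈ transportationPolytope u v := by
      intro c hc
      refine ⟨fun i j => ?_, fun i => ?_, fun j => ?_⟩
      · have h₁ := hle (i, j)
        rw [← hc, ← abs_mul] at h₁
        have h₂ := neg_abs_le (c * d i j)
        simp only [Pi.add_apply, Pi.smul_apply, smul_eq_mul]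
        linarith
      · simp [Finset.sum_add_distrib, ← Finset.mul_sum, hrow, hx.2.1]
      · simp [Finset.sum_add_distrib, ← Finset.mul_sum, hcol, hx.2.2]
    have hseg : x ∈ openSegment ℝ (x + ε • d) (x + (-ε) • d) :=
      ⟨1 / 2, 1 / 2, by norm_num, by norm_num, by norm_num, by module⟩
    have h := hext.2 (hmem ε (abs_of_pos hε)) (hmem (-ε) (by rw [abs_neg, abs_of_pos hε])) hseg
    exact (smul_eq_zero.1 (add_eq_left.1 h)).resolve_left hε.ne'
  · intro h
    refine ⟨hx, fun y hy z hz hseg => ?_⟩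
    obtain ⟨s, t, hs, ht, -, rfl⟩ := hseg
    refine sub_eq_zero.1 (h _ (fun i j hij => ?_) (fun i => ?_) (fun j => ?_))
    · have h₁ := hy.1 i j
      have h₂ := mul_nonneg ht.le (hz.1 i j)
      have h₃ := hx.1 i j
      simp only [Pi.add_apply, Pi.smul_apply, smul_eq_mul, Pi.sub_apply] at hij h₃ ⊢
      have h₄ : y i j = 0 := by
        by_contra hne
        have := mul_pos hs (lt_of_le_of_ne h₁ (Ne.symm hne))
        linarith
      linarith
    · simp only [Pi.sub_apply, Finset.sum_sub_distrib]
      rw [hy.2.1, hx.2.1, sub_self]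
    · simp only [Pi.sub_apply, Finset.sum_sub_distrib]
      rw [hy.2.2, hx.2.2, sub_self]

end Transportation

/-- In a generic classical transportation polytope, a point is a vertex if and only if its
support has exactly `p + q - 1` elements. -/
theorem extremePoint_iff_support_ncard
    (p q : ℕ) (hp : 1 ≤ p) (hq : 1 ≤ q)
    (u : Fin p → ℝ) (v : Fin q → ℝ)
    (hu : ∀ i, 0 < u i) (hv : ∀ j, 0 < v j)
    (hgen : IsGeneric u v)
    (x : Fin p → Fin q → ℝ) (hx : x ∈ transportationPolytope u v) :
    x ∈ Set.extremePoints ℝ (transportationPolytope u v) ↔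
      Set.ncard {ij : Fin p × Fin q | 0 < x ij.1 ij.2} = p + q - 1 := by
  classical
  let S : Finset (Fin p × Fin q) := {ij | 0 < x ij.1 ij.2}
  have hmem : ∀ i j, (i, j) ∈ S ↔ 0 < x i j := fun i j => by simp [S]
  have hcard : Set.ncard {ij : Fin p × Fin q | 0 < x ij.1 ij.2} = Fintype.card S := by
    rw [Fintype.card_coe, ← Set.ncard_coe_finset]
    simp [S]
  have : Nonempty (Fin p) := ⟨⟨0, hp⟩⟩
  have hrank := rank_bipartiteIncidence_add_one (S := S) fun a b hab =>
    potential_const_of_isGeneric hp hu hv hgen hx fun i j hij => hab (i, j) ((hmem i j).2 hij)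
  rw [Fintype.card_fin, Fintype.card_fin] at hrank
  have hiff : x ∈ Set.extremePoints ℝ (transportationPolytope u v) ↔
      (bipartiteIncidence S).rank = Fintype.card S := by
    rw [mem_extremePoints_transportationPolytope_iff hx, Matrix.rank_eq_card_iff_mulVec_eq_zero]
    constructor
    · intro h d hd
      let f : Fin p → Fin q → ℝ := fun i j => if hij : (i, j) ∈ S then d ⟨(i, j), hij⟩ else 0
      have hf : ∀ i j, (i, j) ∉ S → f i j = 0 := fun i j hij => dif_neg hij
      have hfd : (fun s : S => f s.1.1 s.1.2) = d := funext fun s => dif_pos s.2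
      have hf₀ : f = 0 := h f (fun i j hij => hf i j (mt (hmem i j).1 hij))
        (fun i => by rw [← bipartiteIncidence_mulVec_inl hf, hfd, hd, Pi.zero_apply])
        (fun j => by rw [← bipartiteIncidence_mulVec_inr hf, hfd, hd, Pi.zero_apply])
      rw [← hfd, hf₀]
      rfl
    · intro h d hd hrow hcol
      have hd' : ∀ i j, (i, j) ∉ S → d i j = 0 := fun i j hij => hd i j (mt (hmem i j).2 hij)
      have h₀ := h (fun s => d s.1.1 s.1.2) (by
        ext (i | j)
        · rw [bipartiteIncidence_mulVec_inl hd', hrow, Pi.zero_apply]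
        · rw [bipartiteIncidence_mulVec_inr hd', hcol, Pi.zero_apply])
      ext i j
      by_cases hij : (i, j) ∈ S
      · exact congrFun h₀ ⟨(i, j), hij⟩
      · exact hd' i j hij
  rw [hiff, hcard]
  lia
end
end

section
/- Let p, q ≥ 1, let u : Fin p → ℝ and v : Fin q → ℝ have all entries strictly positive with ∑_i u i = ∑_j v j, and assume the classical transportation polytope T(u,v) is generic. Then for every i₀ ∈ Fin p and every j₀ ∈ Fin q there exists an extreme point x of T(u,v) with x i₀ j₀ > 0. -/
open scoped BigOperators

noncomputable section

theorem isClosed_transportationPolytope {p q : ℕ} (u : Fin p → ℝ) (v : Fin q → ℝ) :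
    IsClosed (transportationPolytope u v) := by
  simp only [transportationPolytope, Set.ofPred_and, Set.ofPred_forall]
  refine IsClosed.inter ?_ (IsClosed.inter ?_ ?_)
  · exact isClosed_iInter fun i => isClosed_iInter fun j =>
      isClosed_le continuous_const (by fun_prop)
  · exact isClosed_iInter fun i => isClosed_eq (by fun_prop) continuous_const
  · exact isClosed_iInter fun j => isClosed_eq (by fun_prop) continuous_const

theorem isCompact_transportationPolytope {p q : ℕ} (u : Fin p → ℝ) (v : Fin q → ℝ) :
    IsCompact (transportationPolytope u v) := by
  refine IsCompact.of_isClosed_subset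
    (isCompact_Icc (a := fun _ _ => (0 : ℝ)) (b := fun i _ => u i))
    (isClosed_transportationPolytope u v) ?_
  rintro x ⟨h0, hrow, -⟩
  refine ⟨fun i j => h0 i j, fun i j => ?_⟩
  exact (Finset.single_le_sum (fun k _ => h0 i k) (Finset.mem_univ j)).trans_eq (hrow i)

theorem convex_transportationPolytope {p q : ℕ} (u : Fin p → ℝ) (v : Fin q → ℝ) :
    Convex ℝ (transportationPolytope u v) := by
  rintro x ⟨hx, hxr, hxc⟩ y ⟨hy, hyr, hyc⟩ a b ha hb hab
  refine ⟨fun i j => add_nonneg (mul_nonneg ha (hx i j)) (mul_nonneg hb (hy i j)),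
    fun i => ?_, fun j => ?_⟩
  · simp [Finset.sum_add_distrib, ← Finset.mul_sum, hxr, hyr, ← add_mul, hab]
  · simp [Finset.sum_add_distrib, ← Finset.mul_sum, hxc, hyc, ← add_mul, hab]

/-- The normalized product of the marginals lies in the transportation polytope. -/
theorem product_mem_transportationPolytope {p q : ℕ} {u : Fin p → ℝ} {v : Fin q → ℝ}
    (hu : ∀ i, 0 ≤ u i) (hv : ∀ j, 0 ≤ v j) (hsum : ∑ i, u i = ∑ j, v j)
    (hpos : 0 < ∑ j, v j) :
    (fun i j => u i * v j / ∑ k, v k) ∈ transportationPolytope u v := by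
  refine ⟨fun i j => div_nonneg (mul_nonneg (hu i) (hv j)) hpos.le, fun i => ?_, fun j => ?_⟩
  · rw [← Finset.sum_div, ← Finset.mul_sum, mul_div_cancel_right₀ _ hpos.ne']
  · rw [← Finset.sum_div, ← Finset.sum_mul, hsum, mul_div_cancel_left₀ _ hpos.ne']

/-- (Permuted northwest corner rule.) In a generic classical transportation polytope with
positive marginals and equal total supply and demand, for every cell `(i₀, j₀)` there is a
vertex whose `(i₀, j₀)` entry is strictly positive. -/
theorem exists_extremePoint_pos_entry
    (p q : ℕ) (hp : 1 ≤ p) (hq : 1 ≤ q)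
    (u : Fin p → ℝ) (v : Fin q → ℝ)
    (hu : ∀ i, 0 < u i) (hv : ∀ j, 0 < v j)
    (hsum : ∑ i, u i = ∑ j, v j)
    (hgen : IsGeneric u v)
    (i₀ : Fin p) (j₀ : Fin q) :
    ∃ x ∈ Set.extremePoints ℝ (transportationPolytope u v), 0 < x i₀ j₀ := by
  have hpos : 0 < ∑ j, v j := Finset.sum_pos (fun j _ => hv j) ⟨j₀, Finset.mem_univ j₀⟩
  by_contra! hle
  have hmem := product_mem_transportationPolytope (fun i => (hu i).le) (fun j => (hv j).le)
    hsum hpos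
  rw [← closure_convexHull_extremePoints (isCompact_transportationPolytope u v)
    (convex_transportationPolytope u v)] at hmem
  have hconv : Convex ℝ {x : Fin p → Fin q → ℝ | x i₀ j₀ ≤ 0} :=
    convex_halfSpace_le (f := fun x : Fin p → Fin q → ℝ => x i₀ j₀)
      ⟨fun _ _ => rfl, fun _ _ => rfl⟩ 0
  have hclosed : IsClosed {x : Fin p → Fin q → ℝ | x i₀ j₀ ≤ 0} :=
    isClosed_le (by fun_prop) continuous_const
  have hnonpos := closure_minimal (convexHull_min hle hconv) hclosed hmem
  exact absurd hnonpos (not_le.mpr (div_pos (mul_pos (hu i₀) (hv j₀)) hpos))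
end
end
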